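/- arXiv:2008.11415 — 11 statements merged into one kernel-verified Lean document; each statement's English description precedes it below -/
import Mathlib

section
/- Let d ≥ 3 and let s : {1,…,d} → {+1,−1} be a sequence that takes both values +1 and −1 and is not alternating (i.e., s_i = s_{i+1} for some 1 ≤ i ≤ d−1). Then there exist two monic real polynomials Q₁ and Q₂ of degree d such that: each of Q₁, Q₂ has d real roots, all nonzero, with pairwise distinct absolute values; for each of Q₁, Q₂, if its roots are listed in order of increasing absolute value, the sign of the i-th root equals s_i for every i; all coefficients of Q₁ and of Q₂ are nonzero; and there exists an index k with 0 ≤ k ≤ d such that the coefficient of x^k in Q₁ and the coefficient of x^k in Q₂ have opposite signs. (In other words, every non-alternating moduli order with at least one positive and one negative root is not rigid.) -/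
open Polynomial Finset

/-- The real sequence `r` realizes the sign sequence `s` as a moduli order, and the monic polynomial
with roots `r` has no vanishing coefficient. -/
def RealizesOrder {n : ℕ} (s : Fin n → ℤ) (r : Fin n → ℝ) : Prop :=
  (∀ i, r i ≠ 0) ∧ StrictMono (fun i => |r i|) ∧ (∀ i, 0 < r i ↔ s i = 1) ∧
    ∀ k, k ≤ n → (∏ i, (X - C (r i))).coeff k ≠ 0

/-- Two generic hyperbolic polynomials realize `s` with different sign patterns. -/
def NotRigidOrder {n : ℕ} (s : Fin n → ℤ) : Prop :=
  ∃ r₁ r₂ : Fin n → ℝ, RealizesOrder s r₁ ∧ RealizesOrder s r₂ ∧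
    ∃ k, k ≤ n ∧ (∏ i, (X - C (r₁ i))).coeff k * (∏ i, (X - C (r₂ i))).coeff k < 0

lemma natDegree_prod_X_sub_C_fin {n : ℕ} (r : Fin n → ℝ) :
    (∏ i, (X - C (r i))).natDegree = n := by
  simp

lemma coeff_prod_X_sub_C_fin_self {n : ℕ} (r : Fin n → ℝ) :
    (∏ i, (X - C (r i))).coeff n = 1 := by
  have h := (monic_prod_X_sub_C r univ).coeff_natDegree
  rwa [natDegree_prod_X_sub_C_fin] at h

lemma pos_mul_intCast_iff {a : ℤ} (ha : a = 1 ∨ a = -1) {t : ℝ} (ht : 0 < t) :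
    0 < (a : ℝ) * t ↔ a = 1 := by
  rcases ha with rfl | rfl
  · simpa using ht
  · simpa using ht.le

lemma abs_intCast_mul {a : ℤ} (ha : a = 1 ∨ a = -1) {t : ℝ} (ht : 0 < t) :
    |(a : ℝ) * t| = t := by
  rcases ha with rfl | rfl <;> simp [abs_of_pos ht]

/-- Adding a root of very large modulus multiplies the signs of the low coefficients by a constant
depending only on the sign of the new root. -/
lemma RealizesOrder.exists_snoc {n : ℕ} {s : Fin (n + 1) → ℤ}
    (hs : s (Fin.last n) = 1 ∨ s (Fin.last n) = -1) {r : Fin n → ℝ}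
    (hr : RealizesOrder (fun i => s i.castSucc) r) :
    ∃ r' : Fin (n + 1) → ℝ, RealizesOrder s r' ∧ ∀ k, k ≤ n →
      0 < (∏ i, (X - C (r' i))).coeff k *
        (-(s (Fin.last n) : ℝ) * (∏ i, (X - C (r i))).coeff k) := by
  obtain ⟨h0, hmono, hsign, hcoeff⟩ := hr
  set P : ℝ[X] := ∏ i, (X - C (r i)) with hP
  set a : ℤ := s (Fin.last n) with ha
  have haa : (a : ℝ) * a = 1 := by rcases hs with h | h <;> rw [h] <;> norm_num
  have hev : ∀ᶠ R : ℝ in Filter.atTop, 0 < R ∧ (∀ i, |r i| < R) ∧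
      ∀ k ∈ range (n + 1), (X * P).coeff k * (a * P.coeff k) < R * (P.coeff k) ^ 2 := by
    refine (Filter.eventually_gt_atTop 0).and ((Filter.eventually_all.2 fun i =>
      Filter.eventually_gt_atTop _).and ((Filter.eventually_all_finset _).2 fun k hk => ?_))
    have hk0 : 0 < (P.coeff k) ^ 2 := by
      have := hcoeff k (by simpa [Nat.lt_succ_iff] using hk)
      positivity
    exact (Filter.tendsto_id.atTop_mul_const hk0).eventually_gt_atTop _
  obtain ⟨R, hR0, hRr, hRk⟩ := hev.exists
  have hprod : ∏ i, (X - C ((Fin.snoc r (a * R) : Fin (n + 1) → ℝ) i)) = P * (X - C (a * R)) := by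
    rw [Fin.prod_univ_castSucc]
    simp [hP]
  have key : ∀ k, k ≤ n → 0 < (P * (X - C (a * R))).coeff k * (-(a : ℝ) * P.coeff k) := by
    intro k hk
    have h1 := hRk k (by simpa [Nat.lt_succ_iff] using hk)
    have h2 : (P * (X - C (a * R))).coeff k = (X * P).coeff k - P.coeff k * (a * R) := by
      rw [mul_sub, coeff_sub, coeff_mul_C, mul_comm P X]
    rw [h2]
    linear_combination h1 - R * (P.coeff k) ^ 2 * haa
  refine ⟨Fin.snoc r (a * R), ⟨?_, ?_, ?_, ?_⟩, ?_⟩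
  · refine Fin.lastCases ?_ fun i => ?_
    · rw [Fin.snoc_last, ← abs_pos, abs_intCast_mul hs hR0]
      exact hR0
    · simpa using h0 i
  · intro i j hij
    induction j using Fin.lastCases with
    | last =>
      induction i using Fin.lastCases with
      | last => exact absurd hij (lt_irrefl _)
      | cast i =>
        simp only [Fin.snoc_castSucc, Fin.snoc_last]
        rw [abs_intCast_mul hs hR0]
        exact hRr i
    | cast j =>
      induction i using Fin.lastCases with
      | last => exact absurd hij (Fin.le_last _).not_gt
      | cast i => simpa using hmono (Fin.castSucc_lt_castSucc_iff.1 hij)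
  · refine Fin.lastCases ?_ fun i => ?_
    · rw [Fin.snoc_last]
      exact pos_mul_intCast_iff hs hR0
    · simpa using hsign i
  · intro k hk
    rcases Nat.lt_or_eq_of_le hk with hk | rfl
    · rw [hprod]
      exact left_ne_zero_of_mul (key k (Nat.lt_succ_iff.1 hk)).ne'
    · rw [coeff_prod_X_sub_C_fin_self]
      exact one_ne_zero
  · intro k hk
    rw [hprod]
    exact key k hk

/-- Adding a root of very small modulus shifts the signs of the coefficients. -/
lemma RealizesOrder.exists_cons {n : ℕ} {s : Fin (n + 1) → ℤ}
    (hs : s 0 = 1 ∨ s 0 = -1) {r : Fin n → ℝ}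
    (hr : RealizesOrder (fun i => s i.succ) r) :
    ∃ r' : Fin (n + 1) → ℝ, RealizesOrder s r' ∧ ∀ k, k ≤ n →
      0 < (∏ i, (X - C (r' i))).coeff (k + 1) * (∏ i, (X - C (r i))).coeff k := by
  obtain ⟨h0, hmono, hsign, hcoeff⟩ := hr
  set P : ℝ[X] := ∏ i, (X - C (r i)) with hP
  set a : ℤ := s 0 with ha
  have ha0 : (a : ℝ) ≠ 0 := by rcases hs with h | h <;> rw [h] <;> norm_num
  have hev : ∀ᶠ ε : ℝ in nhdsWithin 0 (Set.Ioi 0), 0 < ε ∧ (∀ i, ε < |r i|) ∧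
      ∀ k ∈ range (n + 1), 0 < (P.coeff k - P.coeff (k + 1) * (a * ε)) * P.coeff k := by
    refine eventually_mem_nhdsWithin.and ((Filter.eventually_all.2 fun i => ?_).and
      ((Filter.eventually_all_finset _).2 fun k hk => ?_))
    · exact nhdsWithin_le_nhds (eventually_lt_nhds (abs_pos.2 (h0 i)))
    · have hk0 := mul_self_pos.2 (hcoeff k (by simpa [Nat.lt_succ_iff] using hk))
      have hc : ContinuousAt
          (fun ε : ℝ => (P.coeff k - P.coeff (k + 1) * (a * ε)) * P.coeff k) 0 := by
        fun_prop
      exact nhdsWithin_le_nhds (hc.eventually_const_lt (by simpa using hk0))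
  obtain ⟨ε, hε0, hεr, hεk⟩ := hev.exists
  have hprod : ∏ i, (X - C ((Fin.cons (a * ε) r : Fin (n + 1) → ℝ) i)) = P * (X - C (a * ε)) := by
    rw [Fin.prod_univ_succ, mul_comm]
    simp [hP]
  have key : ∀ k, k ≤ n → 0 < (P * (X - C (a * ε))).coeff (k + 1) * P.coeff k := by
    intro k hk
    rw [mul_sub, coeff_sub, coeff_mul_C, coeff_mul_X]
    exact hεk k (by simpa [Nat.lt_succ_iff] using hk)
  refine ⟨Fin.cons (a * ε) r, ⟨?_, ?_, ?_, ?_⟩, ?_⟩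
  · refine Fin.cases ?_ fun i => ?_
    · rw [Fin.cons_zero]
      exact mul_ne_zero ha0 hε0.ne'
    · simpa using h0 i
  · intro i j hij
    induction i using Fin.cases with
    | zero =>
      induction j using Fin.cases with
      | zero => exact absurd hij (lt_irrefl _)
      | succ j =>
        simp only [Fin.cons_zero, Fin.cons_succ]
        rw [abs_intCast_mul hs hε0]
        exact hεr j
    | succ i =>
      induction j using Fin.cases with
      | zero => exact absurd hij (Fin.zero_le _).not_gt
      | succ j => simpa using hmono (Fin.succ_lt_succ_iff.1 hij)
  · refine Fin.cases ?_ fun i => ?_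
    · rw [Fin.cons_zero]
      exact pos_mul_intCast_iff hs hε0
    · simpa using hsign i
  · intro k hk
    rw [hprod]
    cases k with
    | zero =>
      rw [mul_coeff_zero]
      simpa using mul_ne_zero (hcoeff 0 (Nat.zero_le _))
        (neg_ne_zero.2 (mul_ne_zero ha0 hε0.ne'))
    | succ k => exact left_ne_zero_of_mul (key k (Nat.succ_le_succ_iff.1 hk)).ne'
  · intro k hk
    rw [hprod]
    exact key k hk

lemma mul_neg_of_mul_pos_of_mul_neg {a b x y : ℝ} (hx : 0 < x * a) (hy : 0 < y * b)
    (hab : a * b < 0) : x * y < 0 := by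
  have h : 0 < (x * y) * (a * b) := by
    rw [mul_mul_mul_comm]
    exact mul_pos hx hy
  exact neg_of_mul_pos_left h hab.le

lemma NotRigidOrder.of_init {n : ℕ} {s : Fin (n + 1) → ℤ}
    (hs : s (Fin.last n) = 1 ∨ s (Fin.last n) = -1)
    (h : NotRigidOrder fun i => s i.castSucc) : NotRigidOrder s := by
  obtain ⟨r₁, r₂, h₁, h₂, k, hk, hneg⟩ := h
  obtain ⟨r₁', h₁', hk₁⟩ := h₁.exists_snoc hs
  obtain ⟨r₂', h₂', hk₂⟩ := h₂.exists_snoc hs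
  refine ⟨r₁', r₂', h₁', h₂', k, hk.trans n.le_succ,
    mul_neg_of_mul_pos_of_mul_neg (hk₁ k hk) (hk₂ k hk) ?_⟩
  rcases hs with h | h <;> rw [h] <;> simpa using hneg

lemma NotRigidOrder.of_tail {n : ℕ} {s : Fin (n + 1) → ℤ} (hs : s 0 = 1 ∨ s 0 = -1)
    (h : NotRigidOrder fun i => s i.succ) : NotRigidOrder s := by
  obtain ⟨r₁, r₂, h₁, h₂, k, hk, hneg⟩ := h
  obtain ⟨r₁', h₁', hk₁⟩ := h₁.exists_cons hs
  obtain ⟨r₂', h₂', hk₂⟩ := h₂.exists_cons hs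
  exact ⟨r₁', r₂', h₁', h₂', k + 1, Nat.succ_le_succ hk,
    mul_neg_of_mul_pos_of_mul_neg (hk₁ k hk) (hk₂ k hk) hneg⟩

lemma prod_X_sub_C_fin_three (r : Fin 3 → ℝ) :
    ∏ i, (X - C (r i)) = C (-(r 0 * r 1 * r 2)) + C (r 0 * r 1 + r 0 * r 2 + r 1 * r 2) * X
      + C (-(r 0 + r 1 + r 2)) * X ^ 2 + X ^ 3 := by
  simp only [Fin.prod_univ_three, map_neg, map_add, map_mul]
  ring

lemma coeff_one_prod_X_sub_C_fin_three (r : Fin 3 → ℝ) :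
    (∏ i, (X - C (r i))).coeff 1 = r 0 * r 1 + r 0 * r 2 + r 1 * r 2 := by
  rw [prod_X_sub_C_fin_three]
  simp only [coeff_add, coeff_C_mul, coeff_C, coeff_X, coeff_X_pow]
  norm_num

lemma coeff_two_prod_X_sub_C_fin_three (r : Fin 3 → ℝ) :
    (∏ i, (X - C (r i))).coeff 2 = -(r 0 + r 1 + r 2) := by
  rw [prod_X_sub_C_fin_three]
  simp only [coeff_add, coeff_C_mul, coeff_C, coeff_X, coeff_X_pow]
  norm_num

/-- For sign sequences of length three, genericity concerns only the two middle coefficients. -/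
lemma RealizesOrder.of_fin_three {s : Fin 3 → ℤ} (hs : ∀ i, s i = 1 ∨ s i = -1) {m : Fin 3 → ℝ}
    (h0 : 0 < m 0) (h01 : m 0 < m 1) (h12 : m 1 < m 2)
    (hc₁ : (∏ i, (X - C ((s i : ℝ) * m i))).coeff 1 ≠ 0)
    (hc₂ : (∏ i, (X - C ((s i : ℝ) * m i))).coeff 2 ≠ 0) :
    RealizesOrder s fun i => s i * m i := by
  have hm : ∀ i, 0 < m i := by
    intro i
    fin_cases i
    · exact h0
    · exact h0.trans h01
    · exact h0.trans (h01.trans h12)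
  have hne : ∀ i, (s i : ℝ) * m i ≠ 0 := fun i => by
    rw [← abs_pos, abs_intCast_mul (hs i) (hm i)]
    exact hm i
  refine ⟨hne, ?_, fun i => pos_mul_intCast_iff (hs i) (hm i), ?_⟩
  · simp only [fun i => abs_intCast_mul (hs i) (hm i)]
    refine Fin.strictMono_iff_lt_succ.2 fun i => ?_
    fin_cases i
    · exact h01
    · exact h12
  · intro k hk
    interval_cases k
    · rw [coeff_zero_prod]
      simpa [prod_ne_zero_iff] using hne
    · exact hc₁
    · exact hc₂
    · rw [coeff_prod_X_sub_C_fin_self]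
      exact one_ne_zero

lemma notRigidOrder_fin_three {s : Fin 3 → ℤ} (hs : ∀ i, s i = 1 ∨ s i = -1)
    (h : s 0 ≠ s 2) : NotRigidOrder s := by
  have h02 : s 2 = - s 0 := by
    rcases hs 0 with h0 | h0 <;> rcases hs 2 with h2 | h2 <;> simp_all
  refine ⟨fun i => s i * (![1, 10, 20] : Fin 3 → ℝ) i, fun i => s i * (![4, 5, 6] : Fin 3 → ℝ) i,
    .of_fin_three hs ?_ ?_ ?_ ?_ ?_, .of_fin_three hs ?_ ?_ ?_ ?_ ?_, if s 1 = s 0 then 2 else 1,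
    ?_, ?_⟩
  all_goals
    rcases hs 0 with h0 | h0 <;> rcases hs 1 with h1 | h1 <;>
      simp only [coeff_one_prod_X_sub_C_fin_three, coeff_two_prod_X_sub_C_fin_three, h02, h0, h1,
        Matrix.cons_val, Int.reduceNeg, Int.reduceEq, if_true, if_false] <;>
      norm_num

lemma notRigidOrder_of_ne : ∀ {d : ℕ} {s : Fin d → ℤ}, (∀ i, s i = 1 ∨ s i = -1) →
    ∀ (i : ℕ) (hi : i + 2 < d), s ⟨i, by omega⟩ ≠ s ⟨i + 2, hi⟩ → NotRigidOrder s := by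
  intro d
  induction d with
  | zero => intro s _ i hi; omega
  | succ d ih =>
    intro s hs i hi hne
    by_cases hd : i + 2 < d
    · exact .of_init (hs _) (ih (fun j => hs _) i hd hne)
    cases i with
    | zero =>
      obtain rfl : d = 2 := by omega
      exact notRigidOrder_fin_three hs hne
    | succ i => exact .of_tail (hs _) (ih (fun j => hs _) i (by omega) hne)

/-- A sequence of period two with two equal adjacent terms is constant. -/
lemma eq_of_add_two_eq_of_adjacent_eq {α : Type*} {d : ℕ} {s : Fin d → α}
    (h2 : ∀ (i : ℕ) (hi : i + 2 < d), s ⟨i, by omega⟩ = s ⟨i + 2, hi⟩)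
    (hadj : ∃ i : Fin d, ∃ h : (i : ℕ) + 1 < d, s i = s ⟨(i : ℕ) + 1, h⟩) (i j : Fin d) :
    s i = s j := by
  obtain ⟨⟨p, hp'⟩, hp, hpp⟩ := hadj
  have hdown : ∀ (q : ℕ) (hq : q + 1 < d), q ≤ p →
      s ⟨q, by omega⟩ = s ⟨q + 1, hq⟩ → s ⟨0, by omega⟩ = s ⟨1, by omega⟩ := by
    intro q
    induction q with
    | zero => intro _ _ h; exact h
    | succ q ih =>
      intro hq hqp h
      exact ih (by omega) (by omega) ((h2 q hq).trans h.symm)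
  have h01 := hdown p hp le_rfl hpp
  have hall : ∀ (q : ℕ) (hq : q + 1 < d),
      s ⟨q, by omega⟩ = s ⟨0, by omega⟩ ∧ s ⟨q + 1, hq⟩ = s ⟨0, by omega⟩ := by
    intro q
    induction q with
    | zero => intro _; exact ⟨rfl, h01.symm⟩
    | succ q ih =>
      intro hq
      obtain ⟨h, h'⟩ := ih (by omega)
      exact ⟨h', (h2 q hq).symm.trans h⟩
  have hzero : ∀ i : Fin d, s i = s ⟨0, by omega⟩ := by
    rintro ⟨q, hq⟩
    cases q with
    | zero => rfl
    | succ q => exact (hall q hq).2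
  exact (hzero i).trans (hzero j).symm

/-- For `d ≥ 3`, any moduli order (sequence of root signs listed by
increasing absolute value) that takes both values and is not alternating is not
rigid: it is realized by two hyperbolic polynomials whose sign patterns differ. -/
theorem stmt_0 (d : ℕ) (hd : 3 ≤ d) (s : Fin d → ℤ)
    (hs : ∀ i, s i = 1 ∨ s i = -1)
    (hpos : ∃ i, s i = 1) (hneg : ∃ i, s i = -1)
    (hnotalt : ∃ i : Fin d, ∃ h : (i : ℕ) + 1 < d, s i = s ⟨(i : ℕ) + 1, h⟩) :
    ∃ (r₁ r₂ : Fin d → ℝ) (Q₁ Q₂ : Polynomial ℝ),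
      Q₁ = ∏ i, (X - C (r₁ i)) ∧
      Q₂ = ∏ i, (X - C (r₂ i)) ∧
      (∀ i, r₁ i ≠ 0) ∧ (∀ i, r₂ i ≠ 0) ∧
      StrictMono (fun i => |r₁ i|) ∧ StrictMono (fun i => |r₂ i|) ∧
      (∀ i, 0 < r₁ i ↔ s i = 1) ∧ (∀ i, 0 < r₂ i ↔ s i = 1) ∧
      (∀ k, k ≤ d → Q₁.coeff k ≠ 0) ∧ (∀ k, k ≤ d → Q₂.coeff k ≠ 0) ∧
      ∃ k, k ≤ d ∧ Q₁.coeff k * Q₂.coeff k < 0 := by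
  have hne : ∃ (i : ℕ) (hi : i + 2 < d), s ⟨i, by omega⟩ ≠ s ⟨i + 2, hi⟩ := by
    by_contra! h2
    obtain ⟨i, hi⟩ := hpos
    obtain ⟨j, hj⟩ := hneg
    have := eq_of_add_two_eq_of_adjacent_eq h2 hnotalt i j
    omega
  obtain ⟨i, hi, hne⟩ := hne
  obtain ⟨r₁, r₂, ⟨h0₁, hm₁, hs₁, hc₁⟩, ⟨h0₂, hm₂, hs₂, hc₂⟩, hk⟩ :=
    notRigidOrder_of_ne hs i hi hne
  exact ⟨r₁, r₂, _, _, rfl, rfl, h0₁, h0₂, hm₁, hm₂, hs₁, hs₂, hc₁, hc₂, hk⟩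
end

section
/- Let m ≥ 1 and d = 2m. Let α₁, γ₁, α₂, γ₂, …, α_m, γ_m be positive real numbers satisfying α₁ < γ₁ < α₂ < γ₂ < ⋯ < α_m < γ_m, and let Q = ∏_{i=1}^m (x − α_i) · ∏_{i=1}^m (x + γ_i) be the monic polynomial of degree d with positive roots α_i and negative roots −γ_i. Then every coefficient of Q is nonzero, and for every k with 0 ≤ k ≤ d the coefficient of x^{d−k} in Q is positive if k mod 4 ∈ {0,1} and negative if k mod 4 ∈ {2,3}. (The moduli order r_PN : P<N<P<N<⋯<N forces the sign pattern Σ₊ = (+,+,−,−,+,+,−,−,…).) -/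
open Polynomial Finset

/-- A polynomial of degree at most `n` with `n` distinct positive roots, positive somewhere to the
right of all of them, has coefficients of strictly alternating signs. -/
lemma coeff_alternating_of_pos_roots {n : ℕ} {p : ℝ[X]} (hdeg : p.natDegree ≤ n) {r : Fin n → ℝ}
    (hinj : Function.Injective r) (hpos : ∀ i, 0 < r i) (hroot : ∀ i, p.eval (r i) = 0)
    {z : ℝ} (hz : ∀ i, r i < z) (hpz : 0 < p.eval z) {j : ℕ} (hj : j ≤ n) :
    0 < (-1) ^ j * p.coeff (n - j) := by
  have hdvd : (∏ i, (X - C (r i))) ∣ p :=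
    Finset.prod_dvd_of_coprime
      (fun i _ k _ hik => pairwise_coprime_X_sub_C hinj hik)
      (fun i _ => dvd_iff_isRoot.2 (hroot i))
  obtain ⟨q, hq⟩ := hdvd
  have hmonic : (∏ i, (X - C (r i))).Monic := monic_prod_of_monic _ _ fun i _ => monic_X_sub_C _
  have hcard : (∏ i, (X - C (r i))).natDegree = n := by
    simp [natDegree_prod_of_monic _ _ fun i _ => monic_X_sub_C (r i)]
  have hq0 : q ≠ 0 := by
    rintro rfl
    simp [hq] at hpz
  have hqdeg : q.natDegree = 0 := by
    have h := hmonic.natDegree_mul' hq0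
    rw [← hq, hcard] at h
    omega
  obtain ⟨c, rfl⟩ := natDegree_eq_zero.1 hqdeg
  have hc : 0 < c := by
    rw [hq, eval_mul, eval_C, eval_prod] at hpz
    refine pos_of_mul_pos_right hpz (Finset.prod_nonneg fun i _ => ?_)
    simpa using (hz i).le
  have hcoeff : (∏ i, (X - C (r i))).coeff (n - j) =
      (-1) ^ j * ∑ t ∈ (univ : Finset (Fin n)).powersetCard j, ∏ i ∈ t, r i := by
    have h := Finset.prod_X_add_C_coeff (univ : Finset (Fin n)) (fun i => - r i) (k := n - j)
      (by simp)
    simp only [C_neg, ← sub_eq_add_neg, card_univ, Fintype.card_fin, Nat.sub_sub_self hj] at h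
    rw [h, Finset.mul_sum]
    refine Finset.sum_congr rfl fun t ht => ?_
    rw [Finset.prod_neg, (mem_powersetCard.1 ht).2]
  have hsum : 0 < ∑ t ∈ (univ : Finset (Fin n)).powersetCard j, ∏ i ∈ t, r i :=
    Finset.sum_pos (fun t _ => Finset.prod_pos fun i _ => hpos i)
      (powersetCard_nonempty.2 (by simpa using hj))
  have hsq : ((-1 : ℝ) ^ j) * (-1) ^ j = 1 := by rw [← mul_pow]; simp
  rw [hq, coeff_mul_C, hcoeff, ← mul_assoc, ← mul_assoc, hsq, one_mul]
  exact mul_pos hsum hc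

/-- The odd–even decomposition of a polynomial. -/
lemma eval_eq_contract_two (p : ℝ[X]) (x : ℝ) :
    p.eval x = (contract 2 p).eval (x ^ 2) + x * (contract 2 p.divX).eval (x ^ 2) := by
  have h : p = expand ℝ 2 (contract 2 p) + X * expand ℝ 2 (contract 2 p.divX) := by
    ext k
    rcases k with _ | k
    · simp [coeff_expand, coeff_contract]
    · rw [coeff_add, coeff_X_mul, coeff_expand two_pos, coeff_expand two_pos]
      by_cases hk : 2 ∣ k
      · rw [if_neg (by omega), if_pos hk, coeff_contract two_ne_zero, coeff_divX,
          Nat.div_mul_cancel hk, zero_add]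
      · have hk' : 2 ∣ k + 1 := by omega
        rw [if_pos hk', if_neg hk, coeff_contract two_ne_zero, Nat.div_mul_cancel hk', add_zero]
  conv_lhs => rw [h]
  simp [expand_eval]

lemma exists_root_of_eval_mul_neg {p : ℝ[X]} {a b : ℝ} (hab : a < b)
    (h : p.eval a * p.eval b < 0) : ∃ r, a < r ∧ r < b ∧ p.eval r = 0 := by
  have hc : ContinuousOn (fun x => p.eval x) (Set.Icc a b) := p.continuous.continuousOn
  rcases mul_neg_iff.1 h with ⟨ha, hb⟩ | ⟨ha, hb⟩
  · obtain ⟨r, hr, h0⟩ := intermediate_value_Ioo' hab.le hc ⟨hb, ha⟩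
    exact ⟨r, hr.1, hr.2, h0⟩
  · obtain ⟨r, hr, h0⟩ := intermediate_value_Ioo hab.le hc ⟨ha, hb⟩
    exact ⟨r, hr.1, hr.2, h0⟩

/-- the moduli order r_PN : P<N<P<N<⋯<N (degree d = 2m) forces the
sign pattern Σ₊ = (+,+,−,−,+,+,−,−,…). -/
theorem stmt_1 (m : ℕ) (hm : 1 ≤ m) (α γ : Fin m → ℝ)
    (hα : ∀ i, 0 < α i) (hγ : ∀ i, 0 < γ i)
    (h1 : ∀ i, α i < γ i)
    (h2 : ∀ i : Fin m, ∀ h : (i : ℕ) + 1 < m, γ i < α ⟨(i : ℕ) + 1, h⟩)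
    (Q : Polynomial ℝ)
    (hQ : Q = (∏ i, (X - C (α i))) * ∏ i, (X + C (γ i))) :
    ∀ k ≤ 2 * m,
      Q.coeff (2 * m - k) ≠ 0 ∧
      (k % 4 = 0 ∨ k % 4 = 1 → 0 < Q.coeff (2 * m - k)) ∧
      (k % 4 = 2 ∨ k % 4 = 3 → Q.coeff (2 * m - k) < 0) := by
  obtain ⟨n, rfl⟩ : ∃ n, m = n + 1 := ⟨m - 1, by omega⟩
  have hstep : ∀ i : Fin n, γ i.castSucc < α i.succ := fun i =>
    h2 i.castSucc (by simp)
  have hαmono : StrictMono α :=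
    Fin.strictMono_iff_lt_succ.2 fun i => (h1 _).trans (hstep i)
  have hγmono : StrictMono γ :=
    Fin.strictMono_iff_lt_succ.2 fun i => (hstep i).trans (h1 _)
  have hγα : ∀ i j, i < j → γ i < α j := by
    intro i j hij
    obtain ⟨i, rfl⟩ := Fin.exists_castSucc_eq.2 (Fin.ne_last_of_lt hij)
    exact (hstep i).trans_le (hαmono.monotone (Fin.castSucc_lt_iff_succ_le.1 hij))
  have hαγ : ∀ i j, i ≤ j → α i < γ j := fun i j hij =>
    (h1 i).trans_le (hγmono.monotone hij)
  set A := contract 2 Q with hA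
  set B := contract 2 Q.divX with hB
  have hQα : ∀ i, Q.eval (α i) = 0 := fun i => by
    rw [hQ, eval_mul, eval_prod, Finset.prod_eq_zero (mem_univ i) (by simp), zero_mul]
  have hQγ : ∀ i, Q.eval (-γ i) = 0 := fun i => by
    rw [hQ, eval_mul, eval_prod _ _ (-γ i), eval_prod _ _ (-γ i),
      Finset.prod_eq_zero (f := fun j => eval (-γ i) (X + C (γ j))) (mem_univ i) (by simp),
      mul_zero]
  have hplus : ∀ x, Q.eval x = A.eval (x ^ 2) + x * B.eval (x ^ 2) := eval_eq_contract_two Q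
  have hminus : ∀ x, Q.eval (-x) = A.eval (x ^ 2) - x * B.eval (x ^ 2) := fun x => by
    rw [hplus (-x), neg_sq]; ring
  have hAα : ∀ i, 2 * A.eval (α i ^ 2) = Q.eval (-α i) := fun i => by
    linarith [hplus (α i), hminus (α i), hQα i]
  have hBα : ∀ i, 2 * (α i * B.eval (α i ^ 2)) = -Q.eval (-α i) := fun i => by
    linarith [hplus (α i), hminus (α i), hQα i]
  have hAγ : ∀ i, 2 * A.eval (γ i ^ 2) = Q.eval (γ i) := fun i => by
    linarith [hplus (γ i), hminus (γ i), hQγ i]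
  have hBγ : ∀ i, 2 * (γ i * B.eval (γ i ^ 2)) = Q.eval (γ i) := fun i => by
    linarith [hplus (γ i), hminus (γ i), hQγ i]
  have hprod : ∀ i k, Q.eval (-α i) * Q.eval (γ k) =
      ∏ j, ((α i + α j) * (γ k + γ j)) * ((α i - γ j) * (γ k - α j)) := fun i k => by
    simp only [hQ, eval_mul, eval_prod, ← Finset.prod_mul_distrib]
    refine Finset.prod_congr rfl fun j _ => ?_
    simp only [eval_sub, eval_add, eval_X, eval_C]
    ring
  have hfac : ∀ i k j, 0 < (α i + α j) * (γ k + γ j) := fun i k j =>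
    mul_pos (add_pos (hα i) (hα j)) (add_pos (hγ k) (hγ j))
  have hneg : ∀ i, Q.eval (-α i) * Q.eval (γ i) < 0 := by
    intro i
    rw [hprod, ← Finset.mul_prod_erase _ _ (mem_univ i)]
    refine mul_neg_of_neg_of_pos (mul_neg_of_pos_of_neg (hfac i i i) ?_)
      (Finset.prod_pos fun j hj => mul_pos (hfac i i j) ?_)
    · exact mul_neg_of_neg_of_pos (sub_neg.2 (h1 i)) (sub_pos.2 (h1 i))
    · rcases lt_or_gt_of_ne (ne_of_mem_erase hj) with h | h
      · exact mul_pos (sub_pos.2 (hγα j i h)) (sub_pos.2 (hαγ j i h.le))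
      · exact mul_pos_of_neg_of_neg (sub_neg.2 (hαγ i j h.le)) (sub_neg.2 (hγα i j h))
  have hpos : ∀ i : Fin n, 0 < Q.eval (-α i.succ) * Q.eval (γ i.castSucc) := by
    intro i
    rw [hprod]
    refine Finset.prod_pos fun j _ => mul_pos (hfac _ _ j) ?_
    rcases le_or_gt j i.castSucc with h | h
    · exact mul_pos (sub_pos.2 (hγα _ _ (h.trans_lt i.castSucc_lt_succ)))
        (sub_pos.2 (hαγ _ _ h))
    · exact mul_pos_of_neg_of_neg
        (sub_neg.2 (hαγ _ _ (Fin.castSucc_lt_iff_succ_le.1 h))) (sub_neg.2 (hγα _ _ h))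
  have hlast : 0 < Q.eval (γ (Fin.last n)) := by
    rw [hQ, eval_mul, eval_prod, eval_prod]
    refine mul_pos (Finset.prod_pos fun j _ => ?_) (Finset.prod_pos fun j _ => ?_)
    · simpa using hαγ j _ (Fin.le_last j)
    · simpa using add_pos (hγ (Fin.last n)) (hγ j)
  have hdeg : Q.natDegree ≤ 2 * (n + 1) := by
    rw [hQ]
    refine natDegree_mul_le.trans ?_
    rw [natDegree_prod_of_monic _ _ fun i _ => monic_X_sub_C (α i),
      natDegree_prod_of_monic _ _ fun i _ => monic_X_add_C (γ i)]
    simp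
    omega
  have hAdeg : A.natDegree ≤ n + 1 := natDegree_le_iff_coeff_eq_zero.2 fun N hN => by
    rw [hA, coeff_contract two_ne_zero]
    exact coeff_eq_zero_of_natDegree_lt (by omega)
  have hBdeg : B.natDegree ≤ n := natDegree_le_iff_coeff_eq_zero.2 fun N hN => by
    rw [hB, coeff_contract two_ne_zero, coeff_divX]
    exact coeff_eq_zero_of_natDegree_lt (by omega)
  have hrA : ∀ i, ∃ r, α i ^ 2 < r ∧ r < γ i ^ 2 ∧ A.eval r = 0 := fun i =>
    exists_root_of_eval_mul_neg (pow_lt_pow_left₀ (h1 i) (hα i).le two_ne_zero) <| by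
      have h := hneg i
      rw [← hAα, ← hAγ] at h
      linarith
  have hrB : ∀ i : Fin n, ∃ r, γ i.castSucc ^ 2 < r ∧ r < α i.succ ^ 2 ∧ B.eval r = 0 := fun i =>
    exists_root_of_eval_mul_neg (pow_lt_pow_left₀ (hstep i) (hγ _).le two_ne_zero) <| by
      have h := hpos i
      rw [← neg_neg (Q.eval (-α i.succ)), ← hBα, ← hBγ] at h
      refine neg_of_mul_neg_right (a := 4 * (α i.succ * γ i.castSucc)) ?_
        (by have := mul_pos (hα i.succ) (hγ i.castSucc); positivity)
      linarith
  choose r hr₁ hr₂ hr₃ using hrA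
  choose s hs₁ hs₂ hs₃ using hrB
  have hrmono : StrictMono r := fun i j hij =>
    (hr₂ i).trans ((pow_lt_pow_left₀ (hγα i j hij) (hγ i).le two_ne_zero).trans (hr₁ j))
  have hsmono : StrictMono s := fun i j hij =>
    (hs₂ i).trans ((pow_lt_pow_left₀ (hαγ i.succ j.castSucc (Fin.succ_le_castSucc_iff.2 hij))
      (hα _).le two_ne_zero).trans (hs₁ j))
  have hAcoeff : ∀ l ≤ n + 1, 0 < (-1) ^ l * A.coeff (n + 1 - l) := fun l hl =>
    coeff_alternating_of_pos_roots hAdeg hrmono.injective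
      (fun i => (pow_pos (hα i) 2).trans (hr₁ i)) hr₃ (z := γ (Fin.last n) ^ 2)
      (fun i => (hr₂ i).trans_le
        (pow_le_pow_left₀ (hγ i).le (hγmono.monotone (Fin.le_last i)) 2))
      (by linarith [hAγ (Fin.last n)]) hl
  have hBcoeff : ∀ l ≤ n, 0 < (-1) ^ l * B.coeff (n - l) := fun l hl =>
    coeff_alternating_of_pos_roots hBdeg hsmono.injective
      (fun i => (pow_pos (hγ _) 2).trans (hs₁ i)) hs₃ (z := γ (Fin.last n) ^ 2)
      (fun i => (hs₂ i).trans
        (pow_lt_pow_left₀ (hαγ _ _ (Fin.le_last _)) (hα _).le two_ne_zero))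
      (pos_of_mul_pos_right (a := γ (Fin.last n))
        (by linarith [hBγ (Fin.last n)]) (hγ _).le) hl
  intro k hk
  have key : 0 < (-1) ^ (k / 2) * Q.coeff (2 * (n + 1) - k) := by
    rcases Nat.even_or_odd' k with ⟨l, rfl | rfl⟩
    · have h := hAcoeff l (by omega)
      rw [hA, coeff_contract two_ne_zero] at h
      rwa [show 2 * l / 2 = l by omega, show 2 * (n + 1) - 2 * l = (n + 1 - l) * 2 by omega]
    · have h := hBcoeff l (by omega)
      rw [hB, coeff_contract two_ne_zero, coeff_divX] at h
      rwa [show (2 * l + 1) / 2 = l by omega,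
        show 2 * (n + 1) - (2 * l + 1) = (n - l) * 2 + 1 by omega]
  refine ⟨right_ne_zero_of_mul key.ne', fun h => ?_, fun h => ?_⟩
  · rwa [Even.neg_one_pow (Nat.even_iff.2 (by omega)), one_mul] at key
  · rw [Odd.neg_one_pow (Nat.odd_iff.2 (by omega))] at key
    linarith
end

section
/- Let m ≥ 1 and d = 2m. Let γ₁, α₁, γ₂, α₂, …, γ_m, α_m be positive real numbers satisfying γ₁ < α₁ < γ₂ < α₂ < ⋯ < γ_m < α_m, and let Q = ∏_{i=1}^m (x − α_i) · ∏_{i=1}^m (x + γ_i) be the monic polynomial of degree d with positive roots α_i and negative roots −γ_i. Then every coefficient of Q is nonzero, and for every k with 0 ≤ k ≤ d the coefficient of x^{d−k} in Q is positive if k mod 4 ∈ {0,3} and negative if k mod 4 ∈ {1,2}. (The moduli order r_NP : N<P<N<P<⋯<P forces the sign pattern Σ₋ = (+,−,−,+,+,−,−,+,…).) -/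
open Polynomial Finset

/-- The coefficients of a product of factors `X - r i` with positive `r i` strictly alternate in
sign. -/
lemma coeff_prod_X_sub_C_alternating {ι : Type*} (s : Finset ι) (r : ι → ℝ)
    (hr : ∀ i ∈ s, 0 < r i) (k l : ℕ) (hkl : k + l = s.card) :
    0 < (-1) ^ l * (∏ i ∈ s, (X - C (r i))).coeff k := by
  classical
  induction s using Finset.induction_on generalizing k l with
  | empty =>
    obtain ⟨rfl, rfl⟩ : k = 0 ∧ l = 0 := by simpa using hkl
    simp
  | insert a s ha ih =>
    rw [Finset.card_insert_of_notMem ha] at hkl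
    rw [Finset.prod_insert ha, sub_mul, coeff_sub, coeff_C_mul]
    have hra := hr a (by simp)
    replace ih := ih fun i hi => hr i (by simp [hi])
    have hdeg : (∏ i ∈ s, (X - C (r i))).natDegree = s.card := by simp
    rcases k with _ | k
    · rw [mul_coeff_zero, coeff_X_zero, zero_mul, zero_sub]
      obtain rfl : l = s.card + 1 := by lia
      have := mul_pos hra (ih 0 s.card (by simp))
      rw [pow_succ]
      linarith
    · rw [coeff_X_mul]
      have h1 := ih k l (by lia)
      rcases l with _ | l
      · rw [coeff_eq_zero_of_natDegree_lt (by lia : _ < k + 1)]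
        simpa using h1
      · have := mul_pos hra (ih (k + 1) l (by lia))
        rw [pow_succ] at h1 ⊢
        linarith

/-- A polynomial of degree at most `n` with positive coefficient of `X ^ n` that changes sign on
`n` successive intervals of the positive half-line has strictly alternating coefficients. -/
lemma coeff_alternating_of_sign_changes {P : ℝ[X]} {n : ℕ} (hdeg : P.natDegree ≤ n)
    (hlead : 0 < P.coeff n) (a b : Fin n → ℝ) (ha : ∀ j, 0 < a j) (hab : ∀ j, a j < b j)
    (hba : ∀ i j, i < j → b i ≤ a j) (hP : ∀ j, P.eval (a j) * P.eval (b j) < 0)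
    (k l : ℕ) (hkl : k + l = n) : 0 < (-1) ^ l * P.coeff k := by
  have hroot : ∀ j, ∃ r, a j < r ∧ r < b j ∧ P.eval r = 0 := by
    intro j
    have hc : ContinuousOn (fun x => P.eval x) (Set.Icc (a j) (b j)) := P.continuous.continuousOn
    rcases mul_neg_iff.mp (hP j) with ⟨h1, h2⟩ | ⟨h1, h2⟩
    · obtain ⟨r, hr, h0⟩ := intermediate_value_Ioo' (hab j).le hc ⟨h2, h1⟩
      exact ⟨r, hr.1, hr.2, h0⟩
    · obtain ⟨r, hr, h0⟩ := intermediate_value_Ioo (hab j).le hc ⟨h1, h2⟩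
      exact ⟨r, hr.1, hr.2, h0⟩
  choose r har hrb hr0 using hroot
  have hmono : StrictMono r := fun i j hij => ((hrb i).trans_le (hba i j hij)).trans (har j)
  have hPn : P.natDegree = n := le_antisymm hdeg (le_natDegree_of_ne_zero hlead.ne')
  have hP0 : P ≠ 0 := by
    rintro rfl
    simp at hlead
  have hroots : P.roots = univ.val.map r := by
    symm
    refine Multiset.eq_of_le_of_card_le ?_ ?_
    · rw [Multiset.le_iff_subset (Multiset.Nodup.map hmono.injective univ.nodup)]
      intro x hx
      obtain ⟨j, -, rfl⟩ := Multiset.mem_map.mp hx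
      exact (mem_roots hP0).mpr (hr0 j)
    · simpa [hPn] using P.card_roots'
  have hfac : P = C (P.coeff n) * ∏ j, (X - C (r j)) := by
    have := C_leadingCoeff_mul_prod_multiset_X_sub_C (p := P) (by simp [hroots, hPn])
    rw [hroots, Multiset.map_map, leadingCoeff, hPn] at this
    exact this.symm
  have := mul_pos hlead (coeff_prod_X_sub_C_alternating univ r
    (fun j _ => (ha j).trans (har j)) k l (by simpa using hkl))
  rw [hfac, coeff_C_mul]
  linarith

/-- The decomposition of a polynomial into its even and odd parts. -/
lemma eval_eq_contract_add_contract_divX (Q : ℝ[X]) (x : ℝ) :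
    Q.eval x = (contract 2 Q).eval (x ^ 2) + x * (contract 2 Q.divX).eval (x ^ 2) := by
  have h : Q = expand ℝ 2 (contract 2 Q) + X * expand ℝ 2 (contract 2 Q.divX) := by
    ext n
    rcases n with _ | n
    · simp [coeff_expand, coeff_contract]
    · rw [coeff_add, coeff_X_mul, coeff_expand two_pos, coeff_expand two_pos]
      rcases Nat.even_or_odd' n with ⟨c, rfl | rfl⟩
      · rw [if_neg (by lia), if_pos (by lia), coeff_contract two_ne_zero, coeff_divX, zero_add]
        congr 1
        lia
      · rw [if_pos (by lia), if_neg (by lia), coeff_contract two_ne_zero, add_zero]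
        congr 1
        lia
  conv_lhs => rw [h]
  simp [expand_eval]

/-- the moduli order r_NP : N<P<N<P<⋯<P (degree d = 2m) forces the
sign pattern Σ₋ = (+,−,−,+,+,−,−,+,…). -/
theorem stmt_2 (m : ℕ) (hm : 1 ≤ m) (γ α : Fin m → ℝ)
    (hγ : ∀ i, 0 < γ i) (hα : ∀ i, 0 < α i)
    (h1 : ∀ i, γ i < α i)
    (h2 : ∀ i : Fin m, ∀ h : (i : ℕ) + 1 < m, α i < γ ⟨(i : ℕ) + 1, h⟩)
    (Q : Polynomial ℝ)
    (hQ : Q = (∏ i, (X - C (α i))) * ∏ i, (X + C (γ i))) :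
    ∀ k ≤ 2 * m,
      Q.coeff (2 * m - k) ≠ 0 ∧
      (k % 4 = 0 ∨ k % 4 = 3 → 0 < Q.coeff (2 * m - k)) ∧
      (k % 4 = 1 ∨ k % 4 = 2 → Q.coeff (2 * m - k) < 0) := by
  obtain ⟨n, rfl⟩ : ∃ n, m = n + 1 := ⟨m - 1, by lia⟩
  have hαγ : ∀ i j, i < j → α i < γ j := by
    intro i ⟨j, hj⟩ hij
    induction j with
    | zero => exact absurd hij (by simp)
    | succ j ih =>
      have hstep := h2 ⟨j, by lia⟩ hj
      rcases (Nat.lt_succ_iff.mp (Fin.lt_def.mp hij)).eq_or_lt with h | h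
      · obtain rfl : i = ⟨j, by lia⟩ := Fin.ext h
        exact hstep
      · exact (ih (by lia) h).trans ((h1 _).trans hstep)
  have hA : (∏ i, (X - C (α i))).Monic := monic_prod_of_monic _ _ fun i _ => monic_X_sub_C _
  have hG : (∏ i, (X + C (γ i))).Monic := monic_prod_of_monic _ _ fun i _ => monic_X_add_C _
  have hmonic : Q.Monic := hQ ▸ hA.mul hG
  have hdeg : Q.natDegree = 2 * n + 2 := by
    rw [hQ, hA.natDegree_mul hG, natDegree_prod_of_monic _ _ fun i _ => monic_X_sub_C _,
      natDegree_prod_of_monic _ _ fun i _ => monic_X_add_C _]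
    simp
    ring
  have hnext : Q.coeff (2 * n + 1) < 0 := by
    have h : Q.nextCoeff = -∑ i, α i + ∑ i, γ i := by
      rw [hQ, hA.nextCoeff_mul hG, prod_X_sub_C_nextCoeff,
        Monic.nextCoeff_prod _ _ fun i _ => monic_X_add_C _]
      simp [nextCoeff_X_add_C]
    rw [nextCoeff_of_natDegree_pos (by lia), hdeg] at h
    have := Finset.sum_lt_sum_of_nonempty univ_nonempty fun i (_ : i ∈ univ) => h1 i
    rw [show 2 * n + 1 = 2 * n + 2 - 1 by lia, h]
    linarith
  set E := contract 2 Q with hE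
  set O := contract 2 Q.divX with hO
  have hEc : ∀ k, E.coeff k = Q.coeff (2 * k) := fun k => by
    rw [hE, coeff_contract two_ne_zero, mul_comm]
  have hOc : ∀ k, O.coeff k = Q.coeff (2 * k + 1) := fun k => by
    rw [hO, coeff_contract two_ne_zero, coeff_divX, mul_comm]
  have hsplit := eval_eq_contract_add_contract_divX Q
  rw [← hE, ← hO] at hsplit
  have hQα : ∀ j, Q.eval (α j) = 0 := fun j => by
    rw [hQ, eval_mul, eval_prod, Finset.prod_eq_zero (mem_univ j) (by simp), zero_mul]
  have hQγ : ∀ j, Q.eval (-γ j) = 0 := fun j => by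
    have h : ∏ i, (X + C (γ i)).eval (-γ j) = 0 := Finset.prod_eq_zero (mem_univ j) (by simp)
    rw [hQ, eval_mul, eval_prod univ fun i => X + C (γ i), h, mul_zero]
  have hprod : ∀ i j, Q.eval (γ i) * Q.eval (-α j) =
      (∏ l, (α l + α j) * (γ i + γ l)) * ∏ l, (γ i - α l) * (α j - γ l) := by
    intro i j
    simp only [hQ, eval_mul, eval_prod, ← Finset.prod_mul_distrib]
    refine Finset.prod_congr rfl fun l _ => ?_
    simp
    ring
  have hpos : ∀ i j, 0 < ∏ l, (α l + α j) * (γ i + γ l) := fun i j =>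
    Finset.prod_pos fun l _ => mul_pos (add_pos (hα _) (hα _)) (add_pos (hγ _) (hγ _))
  have hEγ : ∀ j, Q.eval (γ j) = 2 * E.eval (γ j ^ 2) := fun j => by
    have h := hsplit (γ j)
    have h' := hsplit (-γ j)
    rw [hQγ, neg_sq] at h'
    linarith
  have hEα : ∀ j, Q.eval (-α j) = 2 * E.eval (α j ^ 2) := fun j => by
    have h := hsplit (-α j)
    have h' := hsplit (α j)
    rw [hQα] at h'
    rw [neg_sq] at h
    linarith
  have hOγ : ∀ j, Q.eval (γ j) = 2 * (γ j * O.eval (γ j ^ 2)) := fun j => by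
    have h := hsplit (γ j)
    have := hEγ j
    linarith
  have hOα : ∀ j, Q.eval (-α j) = -2 * (α j * O.eval (α j ^ 2)) := fun j => by
    have h := hsplit (-α j)
    have := hEα j
    rw [neg_sq] at h
    linarith
  have hEsign : ∀ k l, k + l = n + 1 → 0 < (-1) ^ l * Q.coeff (2 * k) := by
    intro k l hkl
    rw [← hEc]
    refine coeff_alternating_of_sign_changes ?_ ?_ (fun j => γ j ^ 2) (fun j => α j ^ 2)
      (fun j => pow_pos (hγ j) 2) (fun j => pow_lt_pow_left₀ (h1 j) (hγ j).le two_ne_zero)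
      (fun i j hij => pow_le_pow_left₀ (hα i).le (hαγ i j hij).le 2) ?_ k l hkl
    · refine natDegree_le_iff_coeff_eq_zero.mpr fun N hN => ?_
      rw [hEc]
      exact coeff_eq_zero_of_natDegree_lt (by lia)
    · have : Q.coeff (2 * n + 2) = 1 := hdeg ▸ hmonic.coeff_natDegree
      rw [hEc, mul_add, mul_one, this]
      exact one_pos
    · intro j
      have hneg : ∏ l, (γ j - α l) * (α j - γ l) < 0 := by
        rw [← Finset.mul_prod_erase univ _ (mem_univ j)]
        refine mul_neg_of_neg_of_pos
          (mul_neg_of_neg_of_pos (sub_neg.mpr (h1 j)) (sub_pos.mpr (h1 j)))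
          (Finset.prod_pos fun l hl => ?_)
        rcases lt_or_gt_of_ne (Finset.ne_of_mem_erase hl) with h | h
        · have := hαγ l j h
          exact mul_pos (by linarith) (by linarith [h1 l, h1 j])
        · have := hαγ j l h
          exact mul_pos_of_neg_of_neg (by linarith [h1 l, h1 j]) (by linarith)
      have := mul_neg_of_pos_of_neg (hpos j j) hneg
      rw [← hprod, hEγ, hEα] at this
      linarith
  have hOsign : ∀ k l, k + l = n → 0 < (-1) ^ l * -Q.coeff (2 * k + 1) := by
    intro k l hkl
    rw [← hOc, ← coeff_neg]
    refine coeff_alternating_of_sign_changes ?_ ?_ (fun j : Fin n => α j.castSucc ^ 2)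
      (fun j => γ j.succ ^ 2) (fun j => pow_pos (hα _) 2)
      (fun j => pow_lt_pow_left₀ (hαγ _ _ j.castSucc_lt_succ) (hα _).le two_ne_zero)
      (fun i j hij => pow_le_pow_left₀ (hγ _).le ?_ 2) ?_ k l hkl
    · rw [natDegree_neg]
      refine natDegree_le_iff_coeff_eq_zero.mpr fun N hN => ?_
      rw [hOc]
      exact coeff_eq_zero_of_natDegree_lt (by lia)
    · rw [coeff_neg, hOc]
      exact neg_pos.mpr hnext
    · rcases (Fin.succ_le_castSucc_iff.mpr hij).eq_or_lt with h | h
      · exact h ▸ (h1 _).le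
      · exact ((h1 _).trans ((hαγ _ _ h).trans (h1 _))).le
    · intro j
      have hp : 0 < ∏ l, (γ j.succ - α l) * (α j.castSucc - γ l) := by
        refine Finset.prod_pos fun l _ => ?_
        rcases le_or_gt l j.castSucc with h | h
        · have := hαγ l j.succ (h.trans_lt j.castSucc_lt_succ)
          refine mul_pos (by linarith) ?_
          rcases h.eq_or_lt with h | h
          · rw [h]
            linarith [h1 j.castSucc]
          · linarith [hαγ _ _ h, h1 l, h1 j.castSucc]
        · have := hαγ _ l h
          refine mul_pos_of_neg_of_neg ?_ (by linarith)
          rcases (Fin.castSucc_lt_iff_succ_le.mp h).eq_or_lt with h | h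
          · rw [← h]
            linarith [h1 j.succ]
          · linarith [hαγ _ _ h, h1 l, h1 j.succ]
      have := mul_pos (hpos j.succ j.castSucc) hp
      rw [← hprod, hOγ, hOα] at this
      rw [eval_neg, eval_neg, neg_mul_neg]
      have hc := mul_pos (hγ j.succ) (hα j.castSucc)
      by_contra hcon
      have := mul_nonneg hc.le (not_lt.mp hcon)
      linarith
  intro k hk
  suffices h : (k % 4 = 0 ∨ k % 4 = 3) ∧ 0 < Q.coeff (2 * (n + 1) - k) ∨
      (k % 4 = 1 ∨ k % 4 = 2) ∧ Q.coeff (2 * (n + 1) - k) < 0 by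
    rcases h with ⟨hk, h⟩ | ⟨hk, h⟩
    · exact ⟨h.ne', fun _ => h, by lia⟩
    · exact ⟨h.ne, by lia, fun _ => h⟩
  rcases Nat.even_or_odd' k with ⟨l, rfl | rfl⟩
  · have h := hEsign (n + 1 - l) l (by lia)
    rw [← Nat.mul_sub]
    rcases Nat.even_or_odd l with hl | hl
    · rw [hl.neg_one_pow, one_mul] at h
      exact Or.inl ⟨by grind, h⟩
    · rw [hl.neg_one_pow, neg_one_mul, neg_pos] at h
      exact Or.inr ⟨by grind, h⟩
  · have h := hOsign (n - l) l (by lia)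
    rw [show 2 * (n + 1) - (2 * l + 1) = 2 * (n - l) + 1 by lia]
    rcases Nat.even_or_odd l with hl | hl
    · rw [hl.neg_one_pow, one_mul, neg_pos] at h
      exact Or.inr ⟨by grind, h⟩
    · rw [hl.neg_one_pow, neg_one_mul, neg_neg] at h
      exact Or.inl ⟨by grind, h⟩
end

section
/- Let m ≥ 0 and d = 2m+1. Let α₁, γ₁, α₂, γ₂, …, γ_m, α_{m+1} be positive real numbers satisfying α₁ < γ₁ < α₂ < γ₂ < ⋯ < γ_m < α_{m+1}, and let Q = ∏_{i=1}^{m+1} (x − α_i) · ∏_{j=1}^{m} (x + γ_j) be the monic polynomial of degree d with positive roots α_i and negative roots −γ_j. Then every coefficient of Q is nonzero, and for every k with 0 ≤ k ≤ d the coefficient of x^{d−k} in Q is positive if k mod 4 ∈ {0,3} and negative if k mod 4 ∈ {1,2}. (The moduli order r_PP : P<N<P<N<⋯<P forces the sign pattern Σ₋ = (+,−,−,+,+,−,−,+,…).) -/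
open Polynomial Finset

/-- The coefficients of a monic polynomial with positive roots strictly alternate in sign. -/
theorem prod_X_sub_C_coeff_alternating (n : ℕ) (b : Fin n → ℝ) (hb : ∀ j, 0 < b j) (l : ℕ) :
    0 ≤ (-1) ^ (n + l) * (∏ j, (X - C (b j))).coeff l ∧
      (l ≤ n → 0 < (-1) ^ (n + l) * (∏ j, (X - C (b j))).coeff l) := by
  induction n generalizing l with
  | zero => cases l <;> simp [coeff_one]
  | succ n ih =>
    have ih' := ih (fun j => b j.succ) fun j => hb _
    have h0 := hb 0
    rw [Fin.prod_univ_succ]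
    generalize ∏ j : Fin n, (X - C (b j.succ)) = R at ih'
    cases l with
    | zero =>
      have h := mul_pos h0 ((ih' 0).2 (Nat.zero_le _))
      have e : (-1) ^ (n + 1 + 0) * ((X - C (b 0)) * R).coeff 0
          = b 0 * ((-1) ^ (n + 0) * R.coeff 0) := by
        simp only [mul_coeff_zero, coeff_sub, coeff_X_zero, coeff_C_zero]
        ring
      rw [e]
      exact ⟨h.le, fun _ => h⟩
    | succ l =>
      have e : (-1) ^ (n + 1 + (l + 1)) * ((X - C (b 0)) * R).coeff (l + 1)
          = (-1) ^ (n + l) * R.coeff l + b 0 * ((-1) ^ (n + (l + 1)) * R.coeff (l + 1)) := by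
        rw [sub_mul, coeff_sub, coeff_X_mul, coeff_C_mul]
        ring
      have h := mul_nonneg h0.le (ih' (l + 1)).1
      rw [e]
      exact ⟨add_nonneg (ih' l).1 h,
        fun hl => add_pos_of_pos_of_nonneg ((ih' l).2 (Nat.le_of_succ_le_succ hl)) h⟩

/-- Lagrange interpolation at the nodes `-α i` of a monic polynomial of degree `m`. -/
theorem prod_X_add_C_eq_sum (m : ℕ) (α : Fin (m + 1) → ℝ) (γ : Fin m → ℝ)
    (hα : Function.Injective α) :
    ∏ j, (X + C (γ j)) = ∑ i, C (∏ j, (γ j - α i) / (α (i.succAbove j) - α i)) *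
      ∏ j, (X + C (α (i.succAbove j))) := by
  have hdeg : (∏ j, (X + C (γ j))).degree < ((univ : Finset (Fin (m + 1))).card : WithBot ℕ) := by
    rw [degree_prod, card_univ, Fintype.card_fin]
    simpa using mod_cast Nat.lt_succ_self m
  have hinj : Set.InjOn (fun i => -α i) (univ : Finset (Fin (m + 1))) :=
    (neg_injective.comp hα).injOn
  rw [Lagrange.eq_interpolate hinj hdeg, Lagrange.interpolate_apply]
  refine sum_congr rfl fun i _ => ?_
  have hbasis : Lagrange.basis univ (fun i => -α i) i = ∏ j : Fin m,
      (C (α (i.succAbove j) - α i)⁻¹ * (X + C (α (i.succAbove j)))) := by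
    have herase : univ.erase i = univ.image i.succAbove := by
      ext x
      simp [← Fin.exists_succAbove_eq_iff]
    rw [Lagrange.basis, herase, prod_image (Fin.succAbove_right_injective.injOn)]
    refine prod_congr rfl fun j _ => ?_
    simp only [Lagrange.basisDivisor, map_neg, sub_neg_eq_add, neg_add_eq_sub]
  rw [hbasis, prod_mul_distrib, ← mul_assoc, ← map_prod, ← C_mul, eval_prod, ← prod_mul_distrib]
  simp [div_eq_mul_inv, neg_add_eq_sub]

/-- The interpolation weights are positive when the `γ j` interlace the `α i`. -/
theorem interlacing_weight_pos (m : ℕ) (α : Fin (m + 1) → ℝ) (γ : Fin m → ℝ)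
    (h1 : ∀ i : Fin m, α i.castSucc < γ i) (h2 : ∀ i : Fin m, γ i < α i.succ)
    (i : Fin (m + 1)) : 0 < ∏ j, (γ j - α i) / (α (i.succAbove j) - α i) := by
  have hmono : StrictMono α := Fin.strictMono_iff_lt_succ.2 fun j => (h1 j).trans (h2 j)
  refine prod_pos fun j _ => ?_
  rcases lt_or_ge j.castSucc i with h | h
  · rw [Fin.succAbove_of_castSucc_lt _ _ h]
    have : α j.succ ≤ α i := hmono.monotone (Fin.castSucc_lt_iff_succ_le.1 h)
    exact div_pos_of_neg_of_neg (by linarith [h2 j]) (by linarith [h1 j, h2 j])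
  · rw [Fin.succAbove_of_le_castSucc _ _ h]
    have : α i ≤ α j.castSucc := hmono.monotone h
    exact div_pos (by linarith [h1 j]) (by linarith [h1 j, h2 j])

theorem X_sub_C_mul_expand_coeff_odd (a : ℝ) (R : ℝ[X]) (q : ℕ) :
    ((X - C a) * expand ℝ 2 R).coeff (2 * q + 1) = R.coeff q := by
  rw [sub_mul, coeff_sub, coeff_X_mul, coeff_C_mul, mul_comm 2 q, coeff_expand_mul two_pos,
    coeff_expand two_pos, if_neg (by omega)]
  simp

theorem X_sub_C_mul_expand_coeff_even (a : ℝ) (R : ℝ[X]) (q : ℕ) :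
    ((X - C a) * expand ℝ 2 R).coeff (2 * q) = -(a * R.coeff q) := by
  have hX : (X * expand ℝ 2 R).coeff (2 * q) = 0 := by
    cases q with
    | zero => simp
    | succ q =>
      rw [show 2 * (q + 1) = 2 * q + 1 + 1 by ring, coeff_X_mul, coeff_expand two_pos,
        if_neg (by omega)]
  rw [sub_mul, coeff_sub, hX, coeff_C_mul, mul_comm 2 q, coeff_expand_mul two_pos, zero_sub]

/-- the moduli order r_PP : P<N<P<N<⋯<P (degree d = 2m+1) forces the
sign pattern Σ₋ = (+,−,−,+,+,−,−,+,…). -/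
theorem stmt_3 (m : ℕ) (α : Fin (m + 1) → ℝ) (γ : Fin m → ℝ)
    (hα : ∀ i, 0 < α i) (hγ : ∀ j, 0 < γ j)
    (h1 : ∀ i : Fin m, α i.castSucc < γ i)
    (h2 : ∀ i : Fin m, γ i < α i.succ)
    (Q : Polynomial ℝ)
    (hQ : Q = (∏ i, (X - C (α i))) * ∏ j, (X + C (γ j))) :
    ∀ k ≤ 2 * m + 1,
      Q.coeff (2 * m + 1 - k) ≠ 0 ∧
      (k % 4 = 0 ∨ k % 4 = 3 → 0 < Q.coeff (2 * m + 1 - k)) ∧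
      (k % 4 = 1 ∨ k % 4 = 2 → Q.coeff (2 * m + 1 - k) < 0) := by
  have hmono : StrictMono α := Fin.strictMono_iff_lt_succ.2 fun j => (h1 j).trans (h2 j)
  set w : Fin (m + 1) → ℝ := fun i => ∏ j, (γ j - α i) / (α (i.succAbove j) - α i)
  have w_pos : ∀ i, 0 < w i := interlacing_weight_pos m α γ h1 h2
  set R : Fin (m + 1) → ℝ[X] := fun i => ∏ j, (X - C (α (i.succAbove j) ^ 2)) with hR
  have R_sign : ∀ i, ∀ q ≤ m, 0 < (-1) ^ (m + q) * (R i).coeff q := fun i q =>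
    (prod_X_sub_C_coeff_alternating m _ (fun j => pow_pos (hα _) 2) q).2
  have Q_eq : Q = ∑ i, C (w i) * ((X - C (α i)) * expand ℝ 2 (R i)) := by
    rw [hQ, prod_X_add_C_eq_sum m α γ hmono.injective, mul_sum]
    refine sum_congr rfl fun i _ => ?_
    rw [Fin.prod_univ_succAbove _ i, mul_left_comm, mul_assoc, ← prod_mul_distrib]
    have hexpand : expand ℝ 2 (R i) =
        ∏ j, (X - C (α (i.succAbove j))) * (X + C (α (i.succAbove j))) := by
      rw [hR, map_prod]
      refine prod_congr rfl fun j _ => ?_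
      simp only [map_sub, map_pow, expand_X, expand_C]
      ring
    rw [hexpand]
  have odd_sign : ∀ q ≤ m, 0 < (-1) ^ (m + q) * Q.coeff (2 * q + 1) := by
    intro q hq
    rw [Q_eq, finsetSum_coeff, mul_sum]
    refine sum_pos (fun i _ => ?_) univ_nonempty
    rw [coeff_C_mul, X_sub_C_mul_expand_coeff_odd, mul_left_comm]
    exact mul_pos (w_pos i) (R_sign i q hq)
  have even_sign : ∀ q ≤ m, 0 < (-1) ^ (m + q) * -Q.coeff (2 * q) := by
    intro q hq
    rw [Q_eq, finsetSum_coeff, ← sum_neg_distrib, mul_sum]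
    refine sum_pos (fun i _ => ?_) univ_nonempty
    rw [coeff_C_mul, X_sub_C_mul_expand_coeff_even, ← mul_neg, neg_neg, mul_left_comm,
      mul_left_comm _ (α i)]
    exact mul_pos (w_pos i) (mul_pos (hα i) (R_sign i q hq))
  intro k hk
  obtain ⟨l, rfl | rfl⟩ := Nat.even_or_odd' k
  · have h := odd_sign (m - l) (by omega)
    rw [show 2 * (m - l) + 1 = 2 * m + 1 - 2 * l by omega] at h
    rcases Nat.even_or_odd l with hl | hl
    · rw [Even.neg_one_pow (by grind), one_mul] at h
      exact ⟨h.ne', fun _ => h, fun _ => by grind⟩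
    · rw [Odd.neg_one_pow (by grind), neg_one_mul, neg_pos] at h
      exact ⟨h.ne, fun _ => by grind, fun _ => h⟩
  · have h := even_sign (m - l) (by omega)
    rw [show 2 * (m - l) = 2 * m + 1 - (2 * l + 1) by omega] at h
    rcases Nat.even_or_odd l with hl | hl
    · rw [Even.neg_one_pow (by grind), one_mul, neg_pos] at h
      exact ⟨h.ne, fun _ => by grind, fun _ => h⟩
    · rw [Odd.neg_one_pow (by grind), neg_one_mul, neg_neg] at h
      exact ⟨h.ne', fun _ => h, fun _ => by grind⟩
end

section
/- Let m ≥ 0 and d = 2m+1. Let γ₁, α₁, γ₂, α₂, …, α_m, γ_{m+1} be positive real numbers satisfying γ₁ < α₁ < γ₂ < α₂ < ⋯ < α_m < γ_{m+1}, and let Q = ∏_{i=1}^{m} (x − α_i) · ∏_{j=1}^{m+1} (x + γ_j) be the monic polynomial of degree d with positive roots α_i and negative roots −γ_j. Then every coefficient of Q is nonzero, and for every k with 0 ≤ k ≤ d the coefficient of x^{d−k} in Q is positive if k mod 4 ∈ {0,1} and negative if k mod 4 ∈ {2,3}. (The moduli order r_NN : N<P<N<P<⋯<N forces the sign pattern Σ₊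 = (+,+,−,−,+,+,−,−,…).) -/
open Polynomial Finset

/-- The sign pattern `(+,+,−,−,+,+,−,−,…)`. -/
def signPlus (k : ℕ) : ℝ := if k % 4 < 2 then 1 else -1

lemma signPlus_add_two (k : ℕ) : signPlus (k + 2) = -signPlus k := by
  have : k % 4 < 4 := Nat.mod_lt _ (by norm_num)
  unfold signPlus
  split_ifs <;> first | omega | norm_num

/-- `Q` has degree at most `d`, and the coefficients of `x ^ d, x ^ (d - 1), …, 1` in `Q` are nonzero
with signs `(+,+,−,−,…)`. -/
def HasSignPlus (Q : ℝ[X]) (d : ℕ) : Prop :=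
  (∀ a, d < a → Q.coeff a = 0) ∧ ∀ a b, a + b = d → 0 < signPlus b * Q.coeff a

lemma HasSignPlus.sq_sub_mul_sub {P R : ℝ[X]} {d : ℕ} (hd : 1 ≤ d) (hP : HasSignPlus P d)
    (hR : HasSignPlus R d) {c p : ℝ} (hc : 0 < c) (hp : 0 < p) :
    HasSignPlus ((X ^ 2 - C c) * P - C p * R) (d + 2) := by
  have hcoeff (a : ℕ) : ((X ^ 2 - C c) * P - C p * R).coeff a =
      (if 2 ≤ a then P.coeff (a - 2) else 0) - c * P.coeff a - p * R.coeff a := by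
    simp [sub_mul, coeff_X_pow_mul']
  constructor
  · intro a ha
    rw [hcoeff, if_pos (by omega), hP.1 _ (by omega), hP.1 _ (by omega), hR.1 _ (by omega)]
    simp
  · intro a b hab
    rw [hcoeff]
    have hlow : (hb : 2 ≤ b) →
        0 < signPlus b * (-(c * P.coeff a) - p * R.coeff a) := by
      intro hb
      obtain ⟨b, rfl⟩ := Nat.exists_eq_add_of_le' hb
      have h₁ := mul_pos hc (hP.2 a b (by omega))
      have h₂ := mul_pos hp (hR.2 a b (by omega))
      rw [signPlus_add_two]
      linarith
    by_cases ha : 2 ≤ a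
    · have hhigh := hP.2 (a - 2) b (by omega)
      rw [if_pos ha]
      by_cases hb : 2 ≤ b
      · linarith [hlow hb]
      · rw [hP.1 a (by omega), hR.1 a (by omega)]
        simpa using hhigh
    · rw [if_neg ha, zero_sub]
      exact hlow (by omega)

lemma hasSignPlus_X_add_C {g : ℝ} (hg : 0 < g) : HasSignPlus (X + C g) 1 := by
  constructor
  · intro a ha
    simp [coeff_X, coeff_C, show 1 ≠ a by omega, show a ≠ 0 by omega]
  · intro a b hab
    obtain ⟨rfl, rfl⟩ | ⟨rfl, rfl⟩ : a = 0 ∧ b = 1 ∨ a = 1 ∧ b = 0 := by omega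
    · simpa [signPlus] using hg
    · simp [signPlus]

/-- Lowering the pair `α 0, γ 1` by `α 0 - γ 0` makes the first two roots opposite; the difference of
the two polynomials is a negative multiple of the polynomial with that pair removed. -/
theorem hasSignPlus_of_interlacing (m : ℕ) (γ : Fin (m + 1) → ℝ) (α : Fin m → ℝ)
    (hγ : ∀ j, 0 < γ j) (h1 : ∀ i : Fin m, γ i.castSucc < α i)
    (h2 : ∀ i : Fin m, α i < γ i.succ) :
    HasSignPlus ((∏ i, (X - C (α i))) * ∏ j, (X + C (γ j))) (2 * m + 1) := by
  induction m with
  | zero => simpa using hasSignPlus_X_add_C (hγ 0)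
  | succ m ih =>
    have h01 : γ 0 < α 0 := h1 0
    have h12 : α 0 < γ 1 := h2 0
    have h0 := hγ 0
    have key (g : ℝ) (hg : 0 < g) (hg1 : g < γ 1) :
        HasSignPlus ((∏ i : Fin m, (X - C (α i.succ))) *
          ((X + C g) * ∏ j : Fin m, (X + C (γ j.succ.succ)))) (2 * m + 1) := by
      have := ih (Fin.cons g fun j => γ j.succ.succ) (fun i => α i.succ)
        (Fin.cases hg fun j => hγ _)
        (by
          intro i
          refine lt_of_le_of_lt ?_ (h1 i.succ)
          cases m with
          | zero => exact i.elim0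
          | succ m =>
            refine Fin.cases ?_ (fun j => ?_) i
            · exact hg1.le
            · exact le_rfl)
        (fun i => h2 i.succ)
      simpa [Fin.prod_univ_succ] using this
    have h := (key (γ 1 - α 0 + γ 0) (by linarith) (by linarith)).sq_sub_mul_sub (by omega)
      (key (γ 0) h0 (by linarith)) (pow_pos h0 2)
      (mul_pos (sub_pos.2 h01) (add_pos (hγ 1) h0))
    rw [show 2 * (m + 1) + 1 = 2 * m + 1 + 2 by ring]
    convert h using 1
    simp only [Fin.prod_univ_succ, Fin.succ_zero_eq_one, map_sub, map_add, map_mul, map_pow]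
    ring

/-- the moduli order r_NN : N<P<N<P<⋯<N (degree d = 2m+1) forces the
sign pattern Σ₊ = (+,+,−,−,+,+,−,−,…). -/
theorem stmt_4 (m : ℕ) (γ : Fin (m + 1) → ℝ) (α : Fin m → ℝ)
    (hγ : ∀ j, 0 < γ j) (hα : ∀ i, 0 < α i)
    (h1 : ∀ i : Fin m, γ i.castSucc < α i)
    (h2 : ∀ i : Fin m, α i < γ i.succ)
    (Q : Polynomial ℝ)
    (hQ : Q = (∏ i, (X - C (α i))) * ∏ j, (X + C (γ j))) :
    ∀ k ≤ 2 * m + 1,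
      Q.coeff (2 * m + 1 - k) ≠ 0 ∧
      (k % 4 = 0 ∨ k % 4 = 1 → 0 < Q.coeff (2 * m + 1 - k)) ∧
      (k % 4 = 2 ∨ k % 4 = 3 → Q.coeff (2 * m + 1 - k) < 0) := by
  intro k hk
  have h := (hasSignPlus_of_interlacing m γ α hγ h1 h2).2 (2 * m + 1 - k) k (by omega)
  rw [← hQ] at h
  refine ⟨right_ne_zero_of_mul h.ne', fun hk' => ?_, fun hk' => ?_⟩
  · simpa [signPlus, show k % 4 < 2 by omega] using h
  · simpa [signPlus, show ¬ k % 4 < 2 by omega] using h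
end

section
/- Let m ≥ 0 and d = 2m+1 (so d is odd). Let α₁, γ₁, α₂, γ₂, …, γ_m, α_{m+1} be positive real numbers satisfying the weak interlacing α₁ ≤ γ₁ ≤ α₂ ≤ γ₂ ≤ ⋯ ≤ γ_m ≤ α_{m+1}, and let Q = ∏_{i=1}^{m+1} (x − α_i) · ∏_{j=1}^{m} (x + γ_j) (roots counted with multiplicity, equalities between moduli allowed). Then every coefficient of Q is nonzero, and for every k with 0 ≤ k ≤ d the coefficient of x^{d−k} in Q is positive if k mod 4 ∈ {0,3} and negative if k mod 4 ∈ {1,2}. (A hyperbolic polynomial of odd degree with nonvanishing constant term defining the moduli order admitting equalities r_PP⁰ has no vanishing coefficient and defines Σ₋.) -/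
open Polynomial Finset

/-- `p` has degree at most `2 * m + 1` and its coefficients, read from `X ^ (2 * m + 1)` downwards,
have the signs `+, -, -, +, +, -, -, …`. -/
def HasSigmaMinus (m : ℕ) (p : ℝ[X]) : Prop :=
  (∀ n, 2 * m + 1 < n → p.coeff n = 0) ∧
    ∀ n ≤ 2 * m + 1, 0 < (-1 : ℝ) ^ ((2 * m + 1 - n + 1) / 2) * p.coeff n

theorem HasSigmaMinus.convexCombo {m : ℕ} {p q : ℝ[X]} (hp : HasSigmaMinus m p)
    (hq : HasSigmaMinus m q) {u v : ℝ} (hu : 0 ≤ u) (hv : 0 ≤ v) (huv : u + v = 1) :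
    HasSigmaMinus m (C u * p + C v * q) := by
  refine ⟨fun n hn => by simp [hp.1 n hn, hq.1 n hn], fun n hn => ?_⟩
  have h := convex_Ioi (0 : ℝ) (hp.2 n hn) (hq.2 n hn) hu hv huv
  simp only [smul_eq_mul, Set.mem_Ioi] at h
  simp only [coeff_add, coeff_C_mul]
  linarith

theorem HasSigmaMinus.X_sq_sub_C_sq_mul {m : ℕ} {p : ℝ[X]} (hp : HasSigmaMinus m p) {a : ℝ}
    (ha : 0 < a) : HasSigmaMinus (m + 1) ((X ^ 2 - C a ^ 2) * p) := by
  have hcoeff (n : ℕ) : ((X ^ 2 - C a ^ 2) * p).coeff n =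
      (if 2 ≤ n then p.coeff (n - 2) else 0) - a ^ 2 * p.coeff n := by
    rw [sub_mul, coeff_sub, coeff_X_pow_mul', ← C_pow, coeff_C_mul]
  have hlow (n : ℕ) (hn : n ≤ 2 * m + 1) :
      0 < (-1 : ℝ) ^ ((2 * (m + 1) + 1 - n + 1) / 2) * -(a ^ 2 * p.coeff n) := by
    have he : (2 * (m + 1) + 1 - n + 1) / 2 = (2 * m + 1 - n + 1) / 2 + 1 := by omega
    have h := mul_pos (pow_pos ha 2) (hp.2 n hn)
    rw [he, pow_succ]
    linarith
  have hhigh (n : ℕ) (hn : n ≤ 2 * (m + 1) + 1) (h2 : 2 ≤ n) :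
      0 < (-1 : ℝ) ^ ((2 * (m + 1) + 1 - n + 1) / 2) * p.coeff (n - 2) := by
    have he : 2 * (m + 1) + 1 - n = 2 * m + 1 - (n - 2) := by omega
    rw [he]
    exact hp.2 _ (by omega)
  refine ⟨fun n hn => ?_, fun n hn => ?_⟩
  · rw [hcoeff, hp.1 n (by omega), hp.1 (n - 2) (by omega)]
    simp
  · rw [hcoeff, sub_eq_add_neg, mul_add]
    split_ifs with h2
    · rcases le_or_gt n (2 * m + 1) with h | h
      · exact add_pos (hhigh n hn h2) (hlow n h)
      · simpa [hp.1 n h] using hhigh n hn h2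
    · simpa using hlow n (by omega)

theorem hasSigmaMinus_X_sub_C {a : ℝ} (ha : 0 < a) : HasSigmaMinus 0 (X - C a) := by
  refine ⟨fun n hn => ?_, fun n hn => ?_⟩
  · rw [coeff_sub, coeff_X_of_ne_one (by omega), coeff_C_of_ne_zero (by omega), sub_zero]
  · interval_cases n <;> simp [coeff_X, coeff_C, ha]

/-- The product is affine in the smallest `γ`, so it is a convex combination of its values at the
two neighbouring `α`s; there a factor `X ^ 2 - C a ^ 2` splits off and the remaining moduli still
interlace. -/
theorem hasSigmaMinus_of_interlacing (m : ℕ) (α : Fin (m + 1) → ℝ) (γ : Fin m → ℝ)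
    (hα : ∀ i, 0 < α i) (h1 : ∀ i : Fin m, α i.castSucc ≤ γ i)
    (h2 : ∀ i : Fin m, γ i ≤ α i.succ) :
    HasSigmaMinus m ((∏ i, (X - C (α i))) * ∏ j, (X + C (γ j))) := by
  induction m with
  | zero => simpa using hasSigmaMinus_X_sub_C (hα 0)
  | succ m ih =>
    have h01 : γ 0 ∈ Set.Icc (α 0) (α 1) := ⟨by simpa using h1 0, by simpa using h2 0⟩
    have hdrop (a : ℝ) (ha : 0 < a) (hle : a ≤ α 1) :
        HasSigmaMinus m ((X - C a) * (∏ i : Fin m, (X - C (α i.succ.succ))) *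
          ∏ j : Fin m, (X + C (γ j.succ))) := by
      have h := ih (Fin.cons a fun i : Fin m => α i.succ.succ) (fun j => γ j.succ)
        (fun i => by cases i using Fin.cases <;> simp [ha, hα])
        (fun i => by
          have h := h1 i.succ
          rcases m with _ | m
          · exact i.elim0
          · cases i using Fin.cases with
            | zero => exact hle.trans h
            | succ i => simpa [← Fin.succ_castSucc] using h)
        (fun i => by simpa using h2 i.succ)
      simpa [Fin.prod_univ_succ] using h
    rw [← segment_eq_Icc (h01.1.trans h01.2)] at h01
    obtain ⟨u, v, hu, hv, huv, hγ⟩ := h01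
    have hle : α 0 ≤ α 1 := by simpa using (h1 0).trans (h2 0)
    convert ((hdrop (α 1) (hα 1) le_rfl).X_sq_sub_C_sq_mul (hα 0)).convexCombo
      ((hdrop (α 0) (hα 0) hle).X_sq_sub_C_sq_mul (hα 1)) hu hv huv using 1
    have hC : (C u + C v : ℝ[X]) = 1 := by rw [← C_add, huv, C_1]
    rw [Fin.prod_univ_succ, Fin.prod_univ_succ, Fin.prod_univ_succ (n := m), ← hγ]
    simp only [smul_eq_mul, C_add, C_mul, Fin.succ_zero_eq_one]
    rw [eq_sub_of_add_eq hC]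
    ring

/-- a hyperbolic polynomial of odd degree d = 2m+1 with nonvanishing
constant term defining the moduli order admitting equalities r_PP⁰ (weak
interlacing α₁ ≤ γ₁ ≤ α₂ ≤ ⋯ ≤ γ_m ≤ α_{m+1}) has no vanishing coefficient and
defines the sign pattern Σ₋ = (+,−,−,+,+,−,−,+,…). -/
theorem stmt_5 (m : ℕ) (α : Fin (m + 1) → ℝ) (γ : Fin m → ℝ)
    (hα : ∀ i, 0 < α i) (hγ : ∀ j, 0 < γ j)
    (h1 : ∀ i : Fin m, α i.castSucc ≤ γ i)
    (h2 : ∀ i : Fin m, γ i ≤ α i.succ)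
    (Q : Polynomial ℝ)
    (hQ : Q = (∏ i, (X - C (α i))) * ∏ j, (X + C (γ j))) :
    ∀ k ≤ 2 * m + 1,
      Q.coeff (2 * m + 1 - k) ≠ 0 ∧
      (k % 4 = 0 ∨ k % 4 = 3 → 0 < Q.coeff (2 * m + 1 - k)) ∧
      (k % 4 = 1 ∨ k % 4 = 2 → Q.coeff (2 * m + 1 - k) < 0) := by
  intro k hk
  have h := (hasSigmaMinus_of_interlacing m α γ hα h1 h2).2 (2 * m + 1 - k) (Nat.sub_le _ _)
  rw [← hQ, Nat.sub_sub_self hk] at h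
  refine ⟨right_ne_zero_of_mul h.ne', fun hk4 => ?_, fun hk4 => ?_⟩
  · have he : Even ((k + 1) / 2) := by rw [Nat.even_iff]; omega
    simpa [he.neg_one_pow] using h
  · have ho : Odd ((k + 1) / 2) := by rw [Nat.odd_iff]; omega
    simpa [ho.neg_one_pow] using h
end

section
/- Let m ≥ 0 and d = 2m+1 (so d is odd). Let γ₁, α₁, γ₂, α₂, …, α_m, γ_{m+1} be positive real numbers satisfying the weak interlacing γ₁ ≤ α₁ ≤ γ₂ ≤ α₂ ≤ ⋯ ≤ α_m ≤ γ_{m+1}, and let Q = ∏_{i=1}^{m} (x − α_i) · ∏_{j=1}^{m+1} (x + γ_j) (roots counted with multiplicity, equalities between moduli allowed). Then every coefficient of Q is nonzero, and for every k with 0 ≤ k ≤ d the coefficient of x^{d−k} in Q is positive if k mod 4 ∈ {0,1} and negative if k mod 4 ∈ {2,3}. (A hyperbolic polynomial of odd degree with nonvanishing constant term defining the moduli order admitting equalities r_NN⁰ has no vanishing coefficient and defines Σ₊.) -/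
open Polynomial Finset

/-- If `α` weakly interlaces `γ`, then `∏ (X - α i)` is a convex combination of the products
obtained from `∏ (X - γ j)` by deleting one factor. -/
theorem prod_X_sub_C_mem_convexHull (m : ℕ) (γ : Fin (m + 1) → ℝ) (α : Fin m → ℝ)
    (h1 : ∀ i : Fin m, γ i.castSucc ≤ α i) (h2 : ∀ i : Fin m, α i ≤ γ i.succ) :
    (∏ i, (X - C (α i))) ∈
      convexHull ℝ (Set.range fun j : Fin (m + 1) => ∏ i : Fin m, (X - C (γ (j.succAbove i)))) := by
  induction m with
  | zero => exact subset_convexHull ℝ _ ⟨0, by simp⟩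
  | succ m ih =>
    have hmono : Monotone γ := Fin.monotone_iff_le_succ.2 fun i => (h1 i).trans (h2 i)
    set S := Set.range fun j : Fin (m + 2) => ∏ i : Fin (m + 1), (X - C (γ (j.succAbove i)))
    rw [Fin.prod_univ_castSucc, mul_comm]
    have hprev := ih (fun j => γ j.castSucc) (fun i => α i.castSucc)
      (fun i => h1 i.castSucc) (fun i => h2 i.castSucc)
    suffices h : convexHull ℝ (Set.range fun j : Fin (m + 1) =>
        ∏ i : Fin m, (X - C (γ (j.succAbove i).castSucc))) ⊆
        LinearMap.mulLeft ℝ (X - C (α (Fin.last m))) ⁻¹' convexHull ℝ S from h hprev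
    refine convexHull_min ?_ ((convex_convexHull ℝ S).linear_preimage _)
    rintro _ ⟨j, rfl⟩
    simp only [Set.mem_preimage, LinearMap.mulLeft_apply]
    set P : ℝ[X] := ∏ i : Fin m, (X - C (γ (j.succAbove i).castSucc))
    have hlast : (X - C (γ (Fin.last (m + 1)))) * P ∈ S := by
      refine ⟨j.castSucc, ?_⟩
      simp only [Fin.prod_univ_castSucc (n := m), Fin.castSucc_succAbove_castSucc,
        Fin.succAbove_ne_last_last (Fin.castSucc_ne_last j)]
      rw [mul_comm]
    have hj : (X - C (γ j.castSucc)) * P ∈ S := by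
      refine ⟨Fin.last (m + 1), ?_⟩
      simp only [Fin.succAbove_last]
      rw [Fin.prod_univ_succAbove _ j]
    have hmem : α (Fin.last m) ∈ segment ℝ (γ j.castSucc) (γ (Fin.last (m + 1))) := by
      rw [segment_eq_Icc (hmono (Fin.le_last _))]
      exact ⟨(hmono (Fin.castSucc_le_castSucc_iff.2 (Fin.le_last j))).trans (h1 _), h2 _⟩
    obtain ⟨a, b, ha, hb, hab, h⟩ := hmem
    have hcomb := convex_convexHull ℝ S (subset_convexHull ℝ S hj)
      (subset_convexHull ℝ S hlast) ha hb hab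
    convert hcomb using 1
    have habC : C a + C b = (1 : ℝ[X]) := by rw [← C_add, hab, C_1]
    rw [← h]
    simp only [smul_eq_C_mul, smul_eq_mul, C_add, C_mul]
    linear_combination (-X * P) * habC

/-- The coefficients of a monic polynomial with positive roots strictly alternate in sign. -/
theorem neg_one_pow_mul_coeff_prod_X_sub_C_pos (m : ℕ) (b : Fin m → ℝ) (hb : ∀ i, 0 < b i)
    (k : ℕ) (hk : k ≤ m) : 0 < (-1) ^ (m + k) * (∏ i, (X - C (b i))).coeff k := by
  suffices h : ∀ k, 0 ≤ (-1) ^ (m + k) * (∏ i, (X - C (b i))).coeff k ∧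
      (k ≤ m → 0 < (-1) ^ (m + k) * (∏ i, (X - C (b i))).coeff k) from (h k).2 hk
  clear k hk
  induction m with
  | zero =>
    intro k
    rcases k with _ | k <;> simp [coeff_one]
  | succ m ih =>
    intro k
    have ih' := ih (fun i => b i.succ) fun i => hb _
    rw [Fin.prod_univ_succ]
    set P : ℝ[X] := ∏ i : Fin m, (X - C (b i.succ))
    have hb0 := hb 0
    rcases k with _ | k
    · have h := (ih' 0).2 (Nat.zero_le _)
      have e : (-1) ^ (m + 1 + 0) * ((X - C (b 0)) * P).coeff 0 =
          b 0 * ((-1) ^ (m + 0) * P.coeff 0) := by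
        simp [mul_coeff_zero, pow_succ]; ring
      rw [e]
      exact ⟨by positivity, fun _ => by positivity⟩
    · have e : (-1) ^ (m + 1 + (k + 1)) * ((X - C (b 0)) * P).coeff (k + 1) =
          (-1) ^ (m + k) * P.coeff k + b 0 * ((-1) ^ (m + (k + 1)) * P.coeff (k + 1)) := by
        rw [sub_mul, coeff_sub, coeff_X_mul, coeff_C_mul]
        ring
      rw [e]
      have h0 := mul_nonneg hb0.le (ih' (k + 1)).1
      exact ⟨add_nonneg (ih' k).1 h0,
        fun hk => add_pos_of_pos_of_nonneg ((ih' k).2 (by omega)) h0⟩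

/-- The sign pattern of `(X + g) * ∏ (X ^ 2 - b i)` for positive `g` and `b i`. -/
theorem neg_one_pow_mul_coeff_X_add_C_mul_prod_pos (m : ℕ) (g : ℝ) (hg : 0 < g)
    (b : Fin m → ℝ) (hb : ∀ i, 0 < b i) (n : ℕ) (hn : n ≤ 2 * m + 1) :
    0 < (-1) ^ (m + n / 2) * ((X + C g) * ∏ i, (X ^ 2 - C (b i))).coeff n := by
  have hexp : ∏ i, (X ^ 2 - C (b i)) = expand ℝ 2 (∏ i, (X - C (b i))) := by
    simp [map_prod]
  have hpos := neg_one_pow_mul_coeff_prod_X_sub_C_pos m b hb (n / 2) (by omega)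
  rw [hexp, add_mul, coeff_add, coeff_C_mul]
  set P : ℝ[X] := ∏ i, (X - C (b i))
  obtain ⟨t, rfl | rfl⟩ := Nat.even_or_odd' n
  · have ht : 2 * t / 2 = t := by omega
    have hX : (X * expand ℝ 2 P).coeff (2 * t) = 0 := by
      rcases t with _ | t
      · simp
      · rw [show 2 * (t + 1) = 2 * t + 1 + 1 by ring, coeff_X_mul,
          coeff_expand two_pos, if_neg (by omega)]
    rw [ht] at hpos ⊢
    rw [hX, coeff_expand_mul' two_pos, zero_add, mul_left_comm]
    exact mul_pos hg hpos
  · have ht : (2 * t + 1) / 2 = t := by omega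
    rw [ht] at hpos ⊢
    rwa [coeff_X_mul, coeff_expand_mul' two_pos, coeff_expand two_pos,
      if_neg (by omega), mul_zero, add_zero]

/-- The coefficient signs of `∏ (X - α i) * ∏ (X + γ j)` when `α` weakly interlaces `γ`. -/
theorem neg_one_pow_mul_coeff_interlacing_pos (m : ℕ) (γ : Fin (m + 1) → ℝ) (α : Fin m → ℝ)
    (hγ : ∀ j, 0 < γ j) (h1 : ∀ i : Fin m, γ i.castSucc ≤ α i)
    (h2 : ∀ i : Fin m, α i ≤ γ i.succ) (n : ℕ) (hn : n ≤ 2 * m + 1) :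
    0 < (-1) ^ (m + n / 2) *
      ((∏ i, (X - C (α i))) * ∏ j, (X + C (γ j))).coeff n := by
  let f : ℝ[X] →ₗ[ℝ] ℝ :=
    ((-1 : ℝ) ^ (m + n / 2)) • (lcoeff ℝ n ∘ₗ LinearMap.mulRight ℝ (∏ j, (X + C (γ j))))
  suffices h : convexHull ℝ
      (Set.range fun j : Fin (m + 1) => ∏ i : Fin m, (X - C (γ (j.succAbove i)))) ⊆
      f ⁻¹' Set.Ioi 0 from h (prod_X_sub_C_mem_convexHull m γ α h1 h2)
  refine convexHull_min ?_ ((convex_Ioi 0).linear_preimage f)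
  rintro _ ⟨j, rfl⟩
  have e : (∏ i : Fin m, (X - C (γ (j.succAbove i)))) * ∏ j, (X + C (γ j)) =
      (X + C (γ j)) * ∏ i : Fin m, (X ^ 2 - C (γ (j.succAbove i) ^ 2)) := by
    rw [Fin.prod_univ_succAbove _ j, mul_left_comm, ← prod_mul_distrib]
    congr 1
    refine prod_congr rfl fun i _ => ?_
    rw [C_pow]
    ring
  simp only [f, Set.mem_preimage, Set.mem_Ioi, LinearMap.smul_apply, LinearMap.comp_apply,
    LinearMap.mulRight_apply, lcoeff_apply, smul_eq_mul, e]
  exact neg_one_pow_mul_coeff_X_add_C_mul_prod_pos m _ (hγ j) _ (fun i => pow_pos (hγ _) 2) n hn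

/-- a hyperbolic polynomial of odd degree d = 2m+1 with nonvanishing
constant term defining the moduli order admitting equalities r_NN⁰ (weak
interlacing γ₁ ≤ α₁ ≤ γ₂ ≤ ⋯ ≤ α_m ≤ γ_{m+1}) has no vanishing coefficient and
defines the sign pattern Σ₊ = (+,+,−,−,+,+,−,−,…). -/
theorem stmt_6 (m : ℕ) (γ : Fin (m + 1) → ℝ) (α : Fin m → ℝ)
    (hγ : ∀ j, 0 < γ j) (hα : ∀ i, 0 < α i)
    (h1 : ∀ i : Fin m, γ i.castSucc ≤ α i)
    (h2 : ∀ i : Fin m, α i ≤ γ i.succ)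
    (Q : Polynomial ℝ)
    (hQ : Q = (∏ i, (X - C (α i))) * ∏ j, (X + C (γ j))) :
    ∀ k ≤ 2 * m + 1,
      Q.coeff (2 * m + 1 - k) ≠ 0 ∧
      (k % 4 = 0 ∨ k % 4 = 1 → 0 < Q.coeff (2 * m + 1 - k)) ∧
      (k % 4 = 2 ∨ k % 4 = 3 → Q.coeff (2 * m + 1 - k) < 0) := by
  subst hQ
  intro k hk
  have h := neg_one_pow_mul_coeff_interlacing_pos m γ α hγ h1 h2 (2 * m + 1 - k) (by omega)
  refine ⟨fun h0 => by simp [h0] at h, fun hk4 => ?_, fun hk4 => ?_⟩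
  · have he : Even (m + (2 * m + 1 - k) / 2) := by
      rw [Nat.even_iff]
      omega
    rwa [he.neg_one_pow, one_mul] at h
  · have ho : Odd (m + (2 * m + 1 - k) / 2) := by
      rw [Nat.odd_iff]
      omega
    rw [ho.neg_one_pow] at h
    linarith
end

section
/- Let m ≥ 1 and d = 2m (so d is even). Let α₁, γ₁, …, α_m, γ_m be positive real numbers satisfying the weak interlacing α₁ ≤ γ₁ ≤ α₂ ≤ γ₂ ≤ ⋯ ≤ α_m ≤ γ_m, and let Q = ∏_{i=1}^{m} (x − α_i)(x + γ_i) (roots counted with multiplicity). Then exactly one of the following holds: (i) α_i = γ_i for every i; in this case Q(−x) = Q(x), the coefficient of x^k in Q vanishes for every odd k, and for every j with 0 ≤ j ≤ m the coefficient of x^{2j} in Q has sign (−1)^{m−j}; or (ii) α_i ≠ γ_i for some i; in this case every coefficient of Q is nonzero and for every k with 0 ≤ k ≤ d the coefficient of x^{d−k} in Q is positive if k mod 4 ∈ {0,1} and negative if k mod 4 ∈ {2,3} (the sign pattern Σ₊), and the multiset of roots of Q is not a union of m pairs of the form {a, −a}. -/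
open Polynomial Finset

/-- The reverse of the monic polynomial `∏ i < n, (X - a i) (X + b i)`. -/
noncomputable def reversedProd (a b : ℕ → ℝ) (n : ℕ) : ℝ[X] :=
  ∏ i ∈ range n, (1 + C (b i - a i) * X - C (a i * b i) * X ^ 2)

theorem reverse_X_sub_C_mul_X_add_C (a b : ℝ) :
    ((X - C a) * (X + C b)).reverse = 1 + C (b - a) * X - C (a * b) * X ^ 2 := by
  have key (c : ℝ) : (X + C c).reverse = 1 + C c * X := by
    rw [reverse, natDegree_X_add_C, reflect_add, ← pow_one (X : ℝ[X]), reflect_monomial,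
      reflect_C]
    simp
  rw [reverse_mul_of_domain, sub_eq_add_neg, ← C_neg, key, key]
  simp only [C_neg, C_sub, C_mul]
  ring

theorem reverse_prod_X_sub_C_mul_X_add_C (a b : ℕ → ℝ) (n : ℕ) :
    (∏ i ∈ range n, ((X - C (a i)) * (X + C (b i)))).reverse = reversedProd a b n := by
  induction n with
  | zero => simp [reversedProd, ← C_1, -map_one]
  | succ n ih =>
    rw [prod_range_succ, reverse_mul_of_domain, ih, reverse_X_sub_C_mul_X_add_C, reversedProd,
      reversedProd, prod_range_succ]

theorem natDegree_prod_X_sub_C_mul_X_add_C (a b : ℕ → ℝ) (n : ℕ) :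
    (∏ i ∈ range n, ((X - C (a i)) * (X + C (b i)))).natDegree = 2 * n := by
  rw [natDegree_prod_of_monic _ _ fun i _ => (monic_X_sub_C _).mul (monic_X_add_C _)]
  simp_rw [(monic_X_sub_C _).natDegree_mul (monic_X_add_C _), natDegree_X_sub_C,
    natDegree_X_add_C]
  simp [mul_comm]

theorem coeff_prod_X_sub_C_mul_X_add_C (a b : ℕ → ℝ) {n k : ℕ} (hk : k ≤ 2 * n) :
    (∏ i ∈ range n, ((X - C (a i)) * (X + C (b i)))).coeff (2 * n - k) =
      (reversedProd a b n).coeff k := by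
  rw [← reverse_prod_X_sub_C_mul_X_add_C, coeff_reverse, natDegree_prod_X_sub_C_mul_X_add_C,
    revAt_le hk]

theorem coeff_reversedProd_succ_zero (a b : ℕ → ℝ) (n : ℕ) :
    (reversedProd a b (n + 1)).coeff 0 = (reversedProd a b n).coeff 0 := by
  rw [reversedProd, prod_range_succ, ← reversedProd]
  simp [mul_coeff_zero]

theorem coeff_reversedProd_succ_one (a b : ℕ → ℝ) (n : ℕ) :
    (reversedProd a b (n + 1)).coeff 1 =
      (reversedProd a b n).coeff 1 + (b n - a n) * (reversedProd a b n).coeff 0 := by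
  rw [reversedProd, prod_range_succ, ← reversedProd,
    show ∀ p : ℝ[X], p * (1 + C (b n - a n) * X - C (a n * b n) * X ^ 2) =
      p + C (b n - a n) * (p * X) - C (a n * b n) * (p * X ^ 2) from fun p => by ring]
  rw [coeff_sub, coeff_add, coeff_C_mul, coeff_C_mul, coeff_mul_X, coeff_mul_X_pow']
  simp

theorem coeff_reversedProd_succ_add_two (a b : ℕ → ℝ) (n k : ℕ) :
    (reversedProd a b (n + 1)).coeff (k + 2) =
      (reversedProd a b n).coeff (k + 2) + (b n - a n) * (reversedProd a b n).coeff (k + 1) -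
        a n * b n * (reversedProd a b n).coeff k := by
  rw [reversedProd, prod_range_succ, ← reversedProd,
    show ∀ p : ℝ[X], p * (1 + C (b n - a n) * X - C (a n * b n) * X ^ 2) =
      p + C (b n - a n) * (p * X) - C (a n * b n) * (p * X ^ 2) from fun p => by ring]
  rw [coeff_sub, coeff_add, coeff_C_mul, coeff_C_mul, coeff_mul_X, coeff_mul_X_pow]

/-- The coefficients of even index `2 * i`, with the sign `(-1) ^ i` they have under weak
interlacing removed. -/
noncomputable def evenCoeff (a b : ℕ → ℝ) (n i : ℕ) : ℝ :=
  (-1) ^ i * (reversedProd a b n).coeff (2 * i)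

/-- The coefficients of odd index `2 * i + 1`, with the sign `(-1) ^ i` they have under weak
interlacing removed. -/
noncomputable def oddCoeff (a b : ℕ → ℝ) (n i : ℕ) : ℝ :=
  (-1) ^ i * (reversedProd a b n).coeff (2 * i + 1)

theorem evenCoeff_succ_zero (a b : ℕ → ℝ) (n : ℕ) :
    evenCoeff a b (n + 1) 0 = evenCoeff a b n 0 := by
  simp [evenCoeff, coeff_reversedProd_succ_zero]

theorem oddCoeff_succ_zero (a b : ℕ → ℝ) (n : ℕ) :
    oddCoeff a b (n + 1) 0 = oddCoeff a b n 0 + (b n - a n) * evenCoeff a b n 0 := by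
  simp [evenCoeff, oddCoeff, coeff_reversedProd_succ_one]

theorem evenCoeff_succ_succ (a b : ℕ → ℝ) (n i : ℕ) :
    evenCoeff a b (n + 1) (i + 1) =
      evenCoeff a b n (i + 1) + a n * b n * evenCoeff a b n i -
        (b n - a n) * oddCoeff a b n i := by
  simp only [evenCoeff, oddCoeff, mul_add, mul_one, coeff_reversedProd_succ_add_two]
  ring

theorem oddCoeff_succ_succ (a b : ℕ → ℝ) (n i : ℕ) :
    oddCoeff a b (n + 1) (i + 1) =
      oddCoeff a b n (i + 1) + a n * b n * oddCoeff a b n i +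
        (b n - a n) * evenCoeff a b n (i + 1) := by
  simp only [evenCoeff, oddCoeff, mul_add, mul_one, add_right_comm _ 2 1,
    coeff_reversedProd_succ_add_two]
  ring

theorem evenCoeff_oddCoeff_bounds {a b : ℕ → ℝ} (ha : ∀ i, 0 < a i) (hab : ∀ i, a i ≤ b i)
    (hba : ∀ i, b i ≤ a (i + 1)) (n i : ℕ) :
    0 ≤ evenCoeff a b n i ∧ 0 ≤ oddCoeff a b n i ∧
      oddCoeff a b n i ≤ a n * evenCoeff a b n i ∧ (i ≤ n → 0 < evenCoeff a b n i) := by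
  induction n generalizing i with
  | zero =>
    cases i with
    | zero => simp [evenCoeff, oddCoeff, reversedProd, coeff_one, (ha 0).le]
    | succ i => simp [evenCoeff, oddCoeff, reversedProd, coeff_one]
  | succ n ih =>
    have hb : 0 < b n := (ha n).trans_le (hab n)
    have hd : 0 ≤ b n - a n := sub_nonneg.2 (hab n)
    have hp : 0 < a n * b n := mul_pos (ha n) hb
    cases i with
    | zero =>
      obtain ⟨h1, h2, h3, h4⟩ := ih 0
      rw [evenCoeff_succ_zero, oddCoeff_succ_zero]
      refine ⟨h1, by positivity, ?_, fun _ => h4 n.zero_le⟩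
      nlinarith [mul_le_mul_of_nonneg_right (hba n) h1]
    | succ i =>
      obtain ⟨h1, h2, h3, h4⟩ := ih i
      obtain ⟨k1, k2, k3, k4⟩ := ih (i + 1)
      have low : evenCoeff a b n (i + 1) + a n ^ 2 * evenCoeff a b n i ≤
          evenCoeff a b (n + 1) (i + 1) := by
        rw [evenCoeff_succ_succ]
        nlinarith [mul_le_mul_of_nonneg_left h3 hd]
      have h0 : 0 ≤ a n ^ 2 * evenCoeff a b n i := by positivity
      have hU : 0 ≤ evenCoeff a b (n + 1) (i + 1) := by linarith
      refine ⟨hU, ?_, (?_ : _ ≤ _).trans (mul_le_mul_of_nonneg_right (hba n) hU), fun hi => ?_⟩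
      · rw [oddCoeff_succ_succ]
        positivity
      · rw [oddCoeff_succ_succ, evenCoeff_succ_succ]
        nlinarith [mul_le_mul_of_nonneg_left h3 (sq_nonneg (b n))]
      · have := h4 (by omega)
        have : 0 < a n ^ 2 * evenCoeff a b n i := mul_pos (pow_pos (ha n) 2) this
        linarith

theorem oddCoeff_pos {a b : ℕ → ℝ} (ha : ∀ i, 0 < a i) (hab : ∀ i, a i ≤ b i)
    (hba : ∀ i, b i ≤ a (i + 1)) {n i : ℕ} (hne : ∃ j < n, a j ≠ b j) (hi : i < n) :
    0 < oddCoeff a b n i := by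
  induction n generalizing i with
  | zero => omega
  | succ n ih =>
    have hb : 0 < b n := (ha n).trans_le (hab n)
    have hp : 0 < a n * b n := mul_pos (ha n) hb
    obtain ⟨-, k2, -, k4⟩ := evenCoeff_oddCoeff_bounds ha hab hba n i
    replace k4 := k4 (by omega)
    rcases (hab n).lt_or_eq with hlt | heq
    · have hd : 0 < (b n - a n) * evenCoeff a b n i := mul_pos (sub_pos.2 hlt) k4
      cases i with
      | zero => rw [oddCoeff_succ_zero]; linarith
      | succ i =>
        have := mul_nonneg hp.le (evenCoeff_oddCoeff_bounds ha hab hba n i).2.1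
        rw [oddCoeff_succ_succ]
        linarith
    · obtain ⟨j, hj, hj'⟩ := hne
      have hjn : j < n := by
        rcases Nat.lt_succ_iff_lt_or_eq.1 hj with h | rfl
        · exact h
        · exact absurd heq hj'
      cases i with
      | zero =>
        have := ih ⟨j, hjn, hj'⟩ (i := 0) (by omega)
        simpa [oddCoeff_succ_zero, heq] using this
      | succ i =>
        have := mul_pos hp (ih ⟨j, hjn, hj'⟩ (i := i) (by omega))
        rw [oddCoeff_succ_succ, heq, sub_self, zero_mul]
        rw [heq] at this
        linarith

theorem sum_roots_prod_X_sub_C_mul_X_add_C {ι : Type*} [Fintype ι] (α γ : ι → ℝ) :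
    (∏ i, ((X - C (α i)) * (X + C (γ i)))).roots.sum = ∑ i, (α i - γ i) := by
  have hne : ∀ i, (X - C (α i)) * (X + C (γ i)) ≠ 0 := fun i =>
    ((monic_X_sub_C _).mul (monic_X_add_C _)).ne_zero
  rw [roots_prod _ _ (prod_ne_zero_iff.2 fun i _ => hne i), Multiset.sum_bind]
  refine congrArg Multiset.sum (Multiset.map_congr rfl fun i _ => ?_)
  rw [roots_mul (hne i), roots_X_sub_C, roots_X_add_C]
  simp [sub_eq_add_neg]



/-- for even degree d = 2m and the moduli order admitting equalities
r_PN⁰ (weak interlacing α₁ ≤ γ₁ ≤ ⋯ ≤ α_m ≤ γ_m), exactly one of two cases holds: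
(i) all α_i = γ_i, Q is even, odd coefficients vanish and the coefficient of x^{2j}
has sign (−1)^{m−j}; or (ii) some α_i ≠ γ_i, all coefficients are nonzero, the sign
pattern is Σ₊, and the root multiset is not a union of m opposite pairs. -/
theorem stmt_7 (m : ℕ) (hm : 1 ≤ m) (α γ : Fin m → ℝ)
    (hα : ∀ i, 0 < α i) (hγ : ∀ i, 0 < γ i)
    (h1 : ∀ i, α i ≤ γ i)
    (h2 : ∀ i : Fin m, ∀ h : (i : ℕ) + 1 < m, γ i ≤ α ⟨(i : ℕ) + 1, h⟩)
    (Q : Polynomial ℝ)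
    (hQ : Q = ∏ i, ((X - C (α i)) * (X + C (γ i)))) :
    ((∀ i, α i = γ i) ∧
      Q.comp (-X) = Q ∧
      (∀ k, Odd k → Q.coeff k = 0) ∧
      (∀ j ≤ m, 0 < (-1 : ℝ) ^ (m - j) * Q.coeff (2 * j)))
    ∨
    ((∃ i, α i ≠ γ i) ∧
      (∀ k ≤ 2 * m, Q.coeff k ≠ 0) ∧
      (∀ k ≤ 2 * m,
        (k % 4 = 0 ∨ k % 4 = 1 → 0 < Q.coeff (2 * m - k)) ∧
        (k % 4 = 2 ∨ k % 4 = 3 → Q.coeff (2 * m - k) < 0)) ∧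
      ¬ ∃ a : Fin m → ℝ, Q.roots = ∑ i, ({a i, -a i} : Multiset ℝ)) := by
  obtain ⟨a, b, ha, hab, hba, hαa, hγb⟩ : ∃ a b : ℕ → ℝ, (∀ i, 0 < a i) ∧ (∀ i, a i ≤ b i) ∧
      (∀ i, b i ≤ a (i + 1)) ∧ (∀ i : Fin m, α i = a i) ∧ ∀ i : Fin m, γ i = b i := by
    refine ⟨fun i => if h : i < m then α ⟨i, h⟩ else γ ⟨m - 1, by omega⟩,
      fun i => if h : i < m then γ ⟨i, h⟩ else γ ⟨m - 1, by omega⟩,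
      fun i => ?_, fun i => ?_, fun i => ?_, fun i => by simp, fun i => by simp⟩
    · dsimp only
      split_ifs <;> simp [hα, hγ]
    · dsimp only
      split_ifs <;> simp [h1]
    · dsimp only
      split_ifs with h h' h'
      · exact h2 ⟨i, h⟩ h'
      · obtain rfl : i = m - 1 := by omega
        rfl
      · omega
      · rfl
  have hQ' : Q = ∏ i ∈ range m, ((X - C (a i)) * (X + C (b i))) := by
    rw [hQ, ← Fin.prod_univ_eq_prod_range fun i => (X - C (a i)) * (X + C (b i))]
    simp_rw [hαa, hγb]
  have heven {i k : ℕ} (hi : i ≤ m) (hk : k = 2 * (m - i)) :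
      Q.coeff k = (-1) ^ i * evenCoeff a b m i := by
    rw [hQ', hk, Nat.mul_sub, coeff_prod_X_sub_C_mul_X_add_C a b (by omega), evenCoeff,
      ← mul_assoc, ← mul_pow]
    simp
  have hodd {i : ℕ} (hi : i < m) :
      Q.coeff (2 * m - (2 * i + 1)) = (-1) ^ i * oddCoeff a b m i := by
    rw [hQ', coeff_prod_X_sub_C_mul_X_add_C a b (by omega), oddCoeff, ← mul_assoc, ← mul_pow]
    simp
  have hepos {i : ℕ} (hi : i ≤ m) : 0 < evenCoeff a b m i :=
    (evenCoeff_oddCoeff_bounds ha hab hba m i).2.2.2 hi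
  by_cases heq : ∀ i, α i = γ i
  · have hcomp : Q.comp (-X) = Q := by
      rw [hQ, Polynomial.prod_comp]
      refine prod_congr rfl fun i _ => ?_
      rw [heq i]
      simp only [mul_comp, sub_comp, add_comp, X_comp, C_comp]
      ring
    refine Or.inl ⟨heq, hcomp, fun k hk => ?_, fun j hj => ?_⟩
    · have := congrArg (coeff · k) hcomp
      rw [show (-X : ℝ[X]) = C (-1) * X by simp] at this
      simp only [comp_C_mul_X_coeff, hk.neg_one_pow] at this
      linarith
    · rw [heven (i := m - j) (by omega) (by omega), ← mul_assoc, ← mul_pow]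
      simpa using hepos (i := m - j) (by omega)
  · have hne : ∃ i, α i ≠ γ i := not_forall.1 heq
    have hne' : ∃ j < m, a j ≠ b j := by
      obtain ⟨i, hi⟩ := hne
      exact ⟨i, i.2, by rwa [← hαa, ← hγb]⟩
    have hsign : ∀ k ≤ 2 * m,
        (k % 4 = 0 ∨ k % 4 = 1 → 0 < Q.coeff (2 * m - k)) ∧
        (k % 4 = 2 ∨ k % 4 = 3 → Q.coeff (2 * m - k) < 0) := by
      intro k hk
      obtain ⟨i, rfl | rfl⟩ := k.even_or_odd'
      · rw [heven (i := i) (by omega) (by omega)]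
        have := hepos (i := i) (by omega)
        refine ⟨fun h => ?_, fun h => ?_⟩
        · rwa [Even.neg_one_pow (Nat.even_iff.2 (by omega)), one_mul]
        · rw [Odd.neg_one_pow (Nat.odd_iff.2 (by omega))]
          linarith
      · rw [hodd (by omega)]
        have := oddCoeff_pos ha hab hba hne' (i := i) (by omega)
        refine ⟨fun h => ?_, fun h => ?_⟩
        · rwa [Even.neg_one_pow (Nat.even_iff.2 (by omega)), one_mul]
        · rw [Odd.neg_one_pow (Nat.odd_iff.2 (by omega))]
          linarith
    refine Or.inr ⟨hne, fun k hk => ?_, hsign, ?_⟩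
    · obtain ⟨hpos, hneg⟩ := hsign (2 * m - k) (by omega)
      rw [Nat.sub_sub_self hk] at hpos hneg
      have : (2 * m - k) % 4 < 4 := Nat.mod_lt _ (by norm_num)
      by_cases h : (2 * m - k) % 4 = 0 ∨ (2 * m - k) % 4 = 1
      · exact (hpos h).ne'
      · exact (hneg (by omega)).ne
    · rintro ⟨c, hc⟩
      have hsum : ∑ i, (α i - γ i) = 0 := by
        rw [← sum_roots_prod_X_sub_C_mul_X_add_C, ← hQ, hc, Multiset.sum_sum]
        simp
      obtain ⟨i, hi⟩ := hne
      exact hi <| sub_eq_zero.1 <|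
        (sum_eq_zero_iff_of_nonpos fun i _ => sub_nonpos.2 (h1 i)).1 hsum i (mem_univ i)
end

section
/- Let m ≥ 1 and d = 2m (so d is even). Let γ₁, α₁, …, γ_m, α_m be positive real numbers satisfying the weak interlacing γ₁ ≤ α₁ ≤ γ₂ ≤ α₂ ≤ ⋯ ≤ γ_m ≤ α_m, and let Q = ∏_{i=1}^{m} (x − α_i)(x + γ_i) (roots counted with multiplicity). Then exactly one of the following holds: (i) α_i = γ_i for every i; in this case Q(−x) = Q(x), the coefficient of x^k in Q vanishes for every odd k, and for every j with 0 ≤ j ≤ m the coefficient of x^{2j} in Q has sign (−1)^{m−j}; or (ii) α_i ≠ γ_i for some i; in this case every coefficient of Q is nonzero and for every k with 0 ≤ k ≤ d the coefficient of x^{d−k} in Q is positive if k mod 4 ∈ {0,3} and negative if k mod 4 ∈ {1,2} (the sign pattern Σ₋), and the multiset of roots of Q is not a union of m pairs of the form {a, −a}. -/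
open Polynomial Finset

/-- A number in a closed interval is a convex combination of the end points. -/
lemma exists_convex_weight {x y z : ℝ} (hxy : x ≤ y) (hyz : y ≤ z) :
    ∃ t : ℝ, 0 ≤ t ∧ t ≤ 1 ∧ t * z + (1 - t) * x = y := by
  rcases (hxy.trans hyz).eq_or_lt with rfl | hlt
  · exact ⟨1, by norm_num, le_rfl, by linarith⟩
  · have hpos : 0 < z - x := sub_pos.2 hlt
    refine ⟨(y - x) / (z - x), by apply div_nonneg <;> linarith, ?_, ?_⟩
    · rw [div_le_one hpos]
      linarith
    · field_simp
      ring

/-- If the `γ i` and `α i` interlace weakly, the product of the `(X - α i) (X + γ i)` is a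
combination with nonnegative coefficients of products of even quadratic factors with at most one
factor replaced by `X (X - α i)`. -/
lemma exists_decomposition {ι : Type*} [LinearOrder ι] (γ α : ι → ℝ) (hγ : ∀ i, 0 < γ i)
    (h1 : ∀ i, γ i ≤ α i) (s : Finset ι) (h : ∀ i ∈ s, ∀ j ∈ s, i < j → α i ≤ γ j) :
    ∃ (a : ℝ) (b : ι → ℝ), 0 < a ∧ (∀ i ∈ s, 0 ≤ b i) ∧
      ((∃ i ∈ s, α i ≠ γ i) → 0 < ∑ i ∈ s, b i) ∧
      ∏ i ∈ s, ((X - C (α i)) * (X + C (γ i))) =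
        C a * ∏ i ∈ s, (X ^ 2 - C (α i ^ 2)) +
          X * ∑ i ∈ s, C (b i) * ((X - C (α i)) * ∏ j ∈ s.erase i, (X ^ 2 - C (α j ^ 2))) := by
  induction s using Finset.induction_on_max with
  | empty => exact ⟨1, 0, by simp⟩
  | insert k s hk ih =>
    obtain ⟨a, b, ha, hb, hsum, heq⟩ := ih fun i hi j hj =>
      h i (mem_insert_of_mem hi) j (mem_insert_of_mem hj)
    have hks : k ∉ s := fun hm => lt_irrefl _ (hk k hm)
    have hαk : 0 < α k := (hγ k).trans_le (h1 k)
    have hw : ∀ i, ∃ t : ℝ, i ∈ s → 0 ≤ t ∧ t ≤ 1 ∧ t * α k + (1 - t) * α i = γ k := by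
      intro i
      by_cases hi : i ∈ s
      · obtain ⟨t, ht⟩ := exists_convex_weight
          (h i (mem_insert_of_mem hi) k (mem_insert_self k s) (hk i hi)) (h1 k)
        exact ⟨t, fun _ => ht⟩
      · exact ⟨0, fun hi' => absurd hi' hi⟩
    choose t ht using hw
    have hratio : γ k / α k ≤ 1 := (div_le_one hαk).2 (h1 k)
    set c : ℝ := a * (1 - γ k / α k) + ∑ i ∈ s, b i * (1 - t i) with hc
    have hne : ∀ i ∈ s, i ≠ k := fun i hi => (hk i hi).ne
    have hsumc : ∑ i ∈ insert k s, (if i = k then c else b i * t i) =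
        a * (1 - γ k / α k) + ∑ i ∈ s, b i := by
      rw [sum_insert hks, if_pos rfl,
        sum_congr rfl fun i hi => if_neg (hne i hi), hc, add_assoc, ← sum_add_distrib]
      congr 1
      exact sum_congr rfl fun i _ => by ring
    refine ⟨a * (γ k / α k), fun i => if i = k then c else b i * t i,
      mul_pos ha (div_pos (hγ k) hαk), ?_, ?_, ?_⟩
    · intro i hi
      rcases mem_insert.1 hi with rfl | hi
      · simp only [if_true]
        refine add_nonneg (mul_nonneg ha.le (by linarith)) (sum_nonneg fun j hj => ?_)
        exact mul_nonneg (hb j hj) (by linarith [(ht j hj).2.1])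
      · simp only [if_neg (hne i hi)]
        exact mul_nonneg (hb i hi) (ht i hi).1
    · rintro ⟨i, hi, hne'⟩
      rw [hsumc]
      rcases mem_insert.1 hi with rfl | hi
      · have : γ i / α i < 1 := (div_lt_one hαk).2 (lt_of_le_of_ne (h1 i) hne'.symm)
        exact add_pos_of_pos_of_nonneg (mul_pos ha (by linarith)) (sum_nonneg hb)
      · exact add_pos_of_nonneg_of_pos (mul_nonneg ha.le (by linarith)) (hsum ⟨i, hi, hne'⟩)
    · beta_reduce
      rw [prod_insert hks, prod_insert hks, sum_insert hks, erase_insert hks, heq, if_pos rfl]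
      have hrw : ∑ i ∈ s, C (if i = k then c else b i * t i) *
          ((X - C (α i)) * ∏ j ∈ (insert k s).erase i, (X ^ 2 - C (α j ^ 2))) =
          ∑ i ∈ s, C (b i) * ((X - C (α i)) * ∏ j ∈ s.erase i, (X ^ 2 - C (α j ^ 2))) *
            (C (t i) * (X ^ 2 - C (α k ^ 2))) := by
        refine sum_congr rfl fun i hi => ?_
        rw [if_neg (hne i hi), erase_insert_of_ne (hne i hi).symm,
          prod_insert (fun hm => hks (mem_of_mem_erase hm)), C_mul]
        ring
      have hterm : (∑ i ∈ s, C (b i) *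
            ((X - C (α i)) * ∏ j ∈ s.erase i, (X ^ 2 - C (α j ^ 2)))) *
            ((X - C (α k)) * (X + C (γ k))) =
          ∑ i ∈ s, C (b i) * ((X - C (α i)) * ∏ j ∈ s.erase i, (X ^ 2 - C (α j ^ 2))) *
            (C (t i) * (X ^ 2 - C (α k ^ 2))) +
          C (∑ i ∈ s, b i * (1 - t i)) * ((X - C (α k)) * ∏ i ∈ s, (X ^ 2 - C (α i ^ 2))) := by
        rw [sum_mul, map_sum, sum_mul, ← sum_add_distrib]
        refine sum_congr rfl fun i hi => ?_
        rw [← mul_prod_erase s _ hi, ← (ht i hi).2.2]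
        simp only [C_mul, C_add, C_sub, C_pow, C_1]
        ring
      have hfirst : C a * ((X - C (α k)) * (X + C (γ k))) =
          C (a * (γ k / α k)) * (X ^ 2 - C (α k ^ 2)) +
            X * C (a * (1 - γ k / α k)) * (X - C (α k)) := by
        have hγk : γ k = γ k / α k * α k := by field_simp
        generalize γ k / α k = r at hγk
        rw [hγk]
        simp only [C_mul, C_sub, C_pow, C_1]
        ring
      rw [hrw, hc, C_add]
      linear_combination (∏ i ∈ s, (X ^ 2 - C (α i ^ 2))) * hfirst + X * hterm

/-- The coefficients of a product of factors `X - c i` with all `c i` positive alternate. -/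
lemma alternating_coeff_prod {ι : Type*} (c : ι → ℝ) (hc : ∀ i, 0 < c i) (s : Finset ι) (l : ℕ) :
    0 ≤ (-1 : ℝ) ^ (#s + l) * (∏ i ∈ s, (X - C (c i))).coeff l ∧
      (l ≤ #s → 0 < (-1 : ℝ) ^ (#s + l) * (∏ i ∈ s, (X - C (c i))).coeff l) := by
  classical
  induction s using Finset.induction_on generalizing l with
  | empty =>
    rcases l with _ | l
    · simp
    · simp [coeff_one]
  | insert k s hks ih =>
    rw [prod_insert hks, card_insert_of_notMem hks, mul_comm (X - C (c k)), mul_sub]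
    rcases l with _ | l
    · have := mul_pos (hc k) ((ih 0).2 (Nat.zero_le _))
      have key : (-1 : ℝ) ^ (#s + 1 + 0) *
          ((∏ i ∈ s, (X - C (c i))) * X - (∏ i ∈ s, (X - C (c i))) * C (c k)).coeff 0 =
          c k * ((-1 : ℝ) ^ (#s + 0) * (∏ i ∈ s, (X - C (c i))).coeff 0) := by
        rw [coeff_sub, coeff_mul_X_zero, coeff_mul_C]
        ring
      rw [key]
      exact ⟨this.le, fun _ => this⟩
    · have key : (-1 : ℝ) ^ (#s + 1 + (l + 1)) *
          ((∏ i ∈ s, (X - C (c i))) * X - (∏ i ∈ s, (X - C (c i))) * C (c k)).coeff (l + 1) =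
          (-1 : ℝ) ^ (#s + l) * (∏ i ∈ s, (X - C (c i))).coeff l +
          c k * ((-1 : ℝ) ^ (#s + (l + 1)) * (∏ i ∈ s, (X - C (c i))).coeff (l + 1)) := by
        rw [coeff_sub, coeff_mul_X, coeff_mul_C]
        ring
      have hnext := mul_nonneg (hc k).le (ih (l + 1)).1
      rw [key]
      exact ⟨add_nonneg (ih l).1 hnext,
        fun hl => add_pos_of_pos_of_nonneg ((ih l).2 (by omega)) hnext⟩

lemma prod_sq_sub_eq_expand {ι : Type*} (α : ι → ℝ) (s : Finset ι) :
    ∏ i ∈ s, (X ^ 2 - C (α i ^ 2)) = expand ℝ 2 (∏ i ∈ s, (X - C (α i ^ 2))) := by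
  simp only [map_prod, map_sub, expand_X, expand_C]

lemma coeff_even_expand_sub (p q : ℝ[X]) (l : ℕ) :
    (expand ℝ 2 p - X * expand ℝ 2 q).coeff (2 * l) = p.coeff l := by
  rw [coeff_sub, coeff_expand_mul' two_pos]
  rcases l with _ | l
  · simp
  · rw [show 2 * (l + 1) = 2 * l + 1 + 1 by ring, coeff_X_mul, coeff_expand two_pos,
      if_neg (by omega), sub_zero]

lemma coeff_odd_expand_sub (p q : ℝ[X]) (l : ℕ) :
    (expand ℝ 2 p - X * expand ℝ 2 q).coeff (2 * l + 1) = -q.coeff l := by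
  rw [coeff_sub, coeff_X_mul, coeff_expand_mul' two_pos, coeff_expand two_pos,
    if_neg (by omega), zero_sub]

/-- The signs of the even and odd coefficients of a product of interlacing factors that are not
all even. -/
lemma interlacing_coeff_sign {ι : Type*} [LinearOrder ι] (γ α : ι → ℝ) (hγ : ∀ i, 0 < γ i)
    (h1 : ∀ i, γ i ≤ α i) (s : Finset ι) (h : ∀ i ∈ s, ∀ j ∈ s, i < j → α i ≤ γ j)
    (hne : ∃ i ∈ s, α i ≠ γ i) :
    (∀ l ≤ #s, 0 < (-1 : ℝ) ^ (#s + l) *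
      (∏ i ∈ s, ((X - C (α i)) * (X + C (γ i)))).coeff (2 * l)) ∧
    (∀ l < #s, 0 < (-1 : ℝ) ^ (#s + l) *
      (∏ i ∈ s, ((X - C (α i)) * (X + C (γ i)))).coeff (2 * l + 1)) := by
  obtain ⟨a, b, ha, hb, hsum, heq⟩ := exists_decomposition γ α hγ h1 s h
  have hα : ∀ i, 0 < α i := fun i => (hγ i).trans_le (h1 i)
  have hsq : ∀ i, 0 < α i ^ 2 := fun i => pow_pos (hα i) 2
  have hform : ∏ i ∈ s, ((X - C (α i)) * (X + C (γ i))) =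
      expand ℝ 2 (C a * ∏ i ∈ s, (X - C (α i ^ 2)) +
          X * ∑ i ∈ s, C (b i) * ∏ j ∈ s.erase i, (X - C (α j ^ 2))) -
        X * expand ℝ 2 (∑ i ∈ s, C (b i * α i) * ∏ j ∈ s.erase i, (X - C (α j ^ 2))) := by
    rw [heq]
    simp only [prod_sq_sub_eq_expand]
    simp only [map_add, map_mul, map_sum, expand_C, expand_X, mul_sum]
    rw [add_sub_assoc, ← sum_sub_distrib]
    congr 1
    exact sum_congr rfl fun i _ => by ring
  have hcard : ∀ i ∈ s, #(s.erase i) + 1 = #s := fun i hi => card_erase_add_one hi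
  rw [hform]
  refine ⟨fun l hl => ?_, fun l hl => ?_⟩
  · rw [coeff_even_expand_sub, coeff_add, mul_add, coeff_C_mul, mul_left_comm]
    refine add_pos_of_pos_of_nonneg (mul_pos ha ((alternating_coeff_prod _ hsq s l).2 hl)) ?_
    rcases l with _ | l
    · simp
    · rw [coeff_X_mul, finsetSum_coeff, mul_sum]
      refine sum_nonneg fun i hi => ?_
      have := mul_nonneg (hb i hi) (alternating_coeff_prod _ hsq (s.erase i) l).1
      rw [coeff_C_mul, ← hcard i hi]
      convert this using 1
      ring
  · rw [coeff_odd_expand_sub, finsetSum_coeff, mul_neg, mul_sum, ← sum_neg_distrib]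
    have hterm : ∀ i ∈ s, -((-1 : ℝ) ^ (#s + l) *
        (C (b i * α i) * ∏ j ∈ s.erase i, (X - C (α j ^ 2))).coeff l) =
        b i * (α i * ((-1 : ℝ) ^ (#(s.erase i) + l) *
          (∏ j ∈ s.erase i, (X - C (α j ^ 2))).coeff l)) := by
      intro i hi
      rw [coeff_C_mul, ← hcard i hi]
      ring
    have hpos : ∀ i ∈ s, 0 < α i * ((-1 : ℝ) ^ (#(s.erase i) + l) *
        (∏ j ∈ s.erase i, (X - C (α j ^ 2))).coeff l) := fun i hi =>
      mul_pos (hα i) ((alternating_coeff_prod _ hsq _ l).2 (by have := hcard i hi; omega))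
    rw [sum_congr rfl hterm]
    obtain ⟨i, hi, hbi⟩ := exists_lt_of_sum_lt (f := fun _ => (0 : ℝ)) (by simpa using hsum hne)
    exact sum_pos' (fun j hj => mul_nonneg (hb j hj) (hpos j hj).le)
      ⟨i, hi, mul_pos hbi (hpos i hi)⟩

lemma roots_sum_prod {ι : Type*} (γ α : ι → ℝ) (s : Finset ι) :
    (∏ i ∈ s, ((X - C (α i)) * (X + C (γ i)))).roots.sum = ∑ i ∈ s, (α i - γ i) := by
  have hf : ∀ i, (X - C (α i)) * (X + C (γ i)) ≠ 0 := fun i =>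
    mul_ne_zero (X_sub_C_ne_zero _) (X_add_C_ne_zero _)
  classical
  induction s using Finset.induction_on with
  | empty => simp
  | insert k s hks ih =>
    rw [prod_insert hks, sum_insert hks,
      roots_mul (mul_ne_zero (hf k) (prod_ne_zero_iff.2 fun i _ => hf i)),
      roots_mul (hf k), Multiset.sum_add, Multiset.sum_add, ih, roots_X_sub_C, roots_X_add_C]
    simp [sub_eq_add_neg]

/-- for even degree d = 2m and the moduli order admitting equalities
r_NP⁰ (weak interlacing γ₁ ≤ α₁ ≤ ⋯ ≤ γ_m ≤ α_m), exactly one of two cases holds: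
(i) all α_i = γ_i, Q is even, odd coefficients vanish and the coefficient of x^{2j}
has sign (−1)^{m−j}; or (ii) some α_i ≠ γ_i, all coefficients are nonzero, the sign
pattern is Σ₋, and the root multiset is not a union of m opposite pairs. -/
theorem stmt_8 (m : ℕ) (hm : 1 ≤ m) (γ α : Fin m → ℝ)
    (hγ : ∀ i, 0 < γ i) (hα : ∀ i, 0 < α i)
    (h1 : ∀ i, γ i ≤ α i)
    (h2 : ∀ i : Fin m, ∀ h : (i : ℕ) + 1 < m, α i ≤ γ ⟨(i : ℕ) + 1, h⟩)
    (Q : Polynomial ℝ)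
    (hQ : Q = ∏ i, ((X - C (α i)) * (X + C (γ i)))) :
    ((∀ i, α i = γ i) ∧
      Q.comp (-X) = Q ∧
      (∀ k, Odd k → Q.coeff k = 0) ∧
      (∀ j ≤ m, 0 < (-1 : ℝ) ^ (m - j) * Q.coeff (2 * j)))
    ∨
    ((∃ i, α i ≠ γ i) ∧
      (∀ k ≤ 2 * m, Q.coeff k ≠ 0) ∧
      (∀ k ≤ 2 * m,
        (k % 4 = 0 ∨ k % 4 = 3 → 0 < Q.coeff (2 * m - k)) ∧
        (k % 4 = 1 ∨ k % 4 = 2 → Q.coeff (2 * m - k) < 0)) ∧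
      ¬ ∃ a : Fin m → ℝ, Q.roots = ∑ i, ({a i, -a i} : Multiset ℝ)) := by
  have hchain : ∀ i ∈ (univ : Finset (Fin m)), ∀ j ∈ (univ : Finset (Fin m)),
      i < j → α i ≤ γ j := by
    have hstep : ∀ (n : ℕ) (i : Fin m) (hn : (i : ℕ) + 1 + n < m),
        α i ≤ γ ⟨(i : ℕ) + 1 + n, hn⟩ := by
      intro n i
      induction n with
      | zero => exact fun hn => h2 i hn
      | succ n ih =>
        exact fun hn => (ih (by omega)).trans ((h1 _).trans (h2 ⟨(i : ℕ) + 1 + n, by omega⟩ hn))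
    intro i _ j _ hij
    have hlt : (i : ℕ) < j := hij
    have hj : (i : ℕ) + 1 + (j - (i + 1)) = j := by omega
    convert hstep (j - (i + 1)) i (by omega) using 2
    exact Fin.ext hj.symm
  by_cases heq : ∀ i, α i = γ i
  · have hform : Q = expand ℝ 2 (∏ i, (X - C (α i ^ 2))) := by
      rw [hQ, ← prod_sq_sub_eq_expand]
      refine prod_congr rfl fun i _ => ?_
      rw [← heq i, C_pow]
      ring
    refine Or.inl ⟨heq, ?_, ?_, ?_⟩
    · rw [hform, ← prod_sq_sub_eq_expand, Polynomial.prod_comp]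
      simp
    · intro k hk
      rw [hform, coeff_expand two_pos, if_neg]
      rw [← even_iff_two_dvd]
      exact Nat.not_even_iff_odd.2 hk
    · intro j hj
      have := (alternating_coeff_prod _ (fun i => pow_pos (hα i) 2) univ j).2 (by simpa using hj)
      rw [card_univ, Fintype.card_fin, show m + j = m - j + 2 * j by omega, pow_add, pow_mul,
        neg_one_sq, one_pow, mul_one] at this
      rwa [hform, coeff_expand_mul' two_pos]
  · obtain ⟨i₀, hi₀⟩ := not_forall.1 heq
    obtain ⟨heven, hodd⟩ :=
      interlacing_coeff_sign γ α hγ h1 univ hchain ⟨i₀, mem_univ _, hi₀⟩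
    rw [← hQ, card_univ, Fintype.card_fin] at heven hodd
    have hsign : ∀ k ≤ 2 * m,
        (k % 4 = 0 ∨ k % 4 = 3 → 0 < Q.coeff (2 * m - k)) ∧
        (k % 4 = 1 ∨ k % 4 = 2 → Q.coeff (2 * m - k) < 0) := by
      intro k hk
      rcases Nat.even_or_odd' k with ⟨l, rfl | rfl⟩
      · have hs := heven (m - l) (by omega)
        rw [show m + (m - l) = l + 2 * (m - l) by omega, pow_add, pow_mul, neg_one_sq, one_pow,
          mul_one, show 2 * (m - l) = 2 * m - 2 * l by omega] at hs
        refine ⟨fun hmod => ?_, fun hmod => ?_⟩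
        · rw [Even.neg_one_pow (Nat.even_iff.2 (by omega))] at hs
          linarith
        · rw [Odd.neg_one_pow (Nat.odd_iff.2 (by omega))] at hs
          linarith
      · have hs := hodd (m - l - 1) (by omega)
        rw [show m + (m - l - 1) = l + 1 + 2 * (m - l - 1) by omega, pow_add, pow_mul,
          neg_one_sq, one_pow, mul_one,
          show 2 * (m - l - 1) + 1 = 2 * m - (2 * l + 1) by omega] at hs
        refine ⟨fun hmod => ?_, fun hmod => ?_⟩
        · rw [Even.neg_one_pow (Nat.even_iff.2 (by omega))] at hs
          linarith
        · rw [Odd.neg_one_pow (Nat.odd_iff.2 (by omega))] at hs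
          linarith
    refine Or.inr ⟨⟨i₀, hi₀⟩, ?_, hsign, ?_⟩
    · intro k hk
      have hs := hsign (2 * m - k) (by omega)
      rw [Nat.sub_sub_self hk] at hs
      rcases (by omega : ((2 * m - k) % 4 = 0 ∨ (2 * m - k) % 4 = 3) ∨
          ((2 * m - k) % 4 = 1 ∨ (2 * m - k) % 4 = 2)) with hmod | hmod
      · exact (hs.1 hmod).ne'
      · exact (hs.2 hmod).ne
    · rintro ⟨a, ha⟩
      have hsum := roots_sum_prod γ α univ
      rw [← hQ, ha, Multiset.sum_sum] at hsum
      have hpos : 0 < ∑ i, (α i - γ i) := sum_pos' (fun i _ => sub_nonneg.2 (h1 i))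
        ⟨i₀, mem_univ _, sub_pos.2 (lt_of_le_of_ne (h1 i₀) (Ne.symm hi₀))⟩
      rw [← hsum] at hpos
      simp at hpos
end

section
/- Let m ≥ 1 and let V be a real polynomial of degree m with coefficients c_0, c_1, …, c_m (c_j the coefficient of x^j) such that c_j ≠ 0 for all 0 ≤ j ≤ m and c_j · c_{j+2} < 0 for all 0 ≤ j ≤ m−2. Then for every real number a ≠ 0 the polynomial W = (x² − a²)·V has degree m+2 and satisfies: every coefficient of W is nonzero; for every j with 2 ≤ j ≤ m+2 the coefficient of x^j in W has the same sign as c_{j−2}; for j ∈ {0,1} the coefficient of x^j in W has sign opposite to c_j; and W again satisfies the alternation property, i.e., the product of the coefficients of x^j and x^{j+2} in W is negative for all 0 ≤ j ≤ m. -/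
open Polynomial

theorem coeff_X_sq_sub_C_mul_add_two {R : Type*} [CommRing R] (b : R) (p : R[X]) (j : ℕ) :
    ((X ^ 2 - C b) * p).coeff (j + 2) = p.coeff j - b * p.coeff (j + 2) := by
  rw [sub_mul, coeff_sub, coeff_X_pow_mul, coeff_C_mul]

theorem coeff_X_sq_sub_C_mul_of_lt_two {R : Type*} [CommRing R] (b : R) (p : R[X]) {j : ℕ}
    (hj : j < 2) : ((X ^ 2 - C b) * p).coeff j = -(b * p.coeff j) := by
  rw [sub_mul, coeff_sub, coeff_X_pow_mul', if_neg (by omega), coeff_C_mul, zero_sub]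

/-- if V has degree m ≥ 1, all coefficients nonzero and
c_j·c_{j+2} < 0 for all j, then for a ≠ 0 the polynomial W = (x²−a²)V has degree
m+2, all its coefficients are nonzero, the coefficient of x^j in W has the sign
of c_{j−2} for 2 ≤ j ≤ m+2 and the sign opposite to c_j for j ∈ {0,1}, and W
again satisfies the alternation property. -/
theorem stmt_11 (m : ℕ) (hm : 1 ≤ m) (V : Polynomial ℝ) (hdeg : V.natDegree = m)
    (hnz : ∀ j ≤ m, V.coeff j ≠ 0)
    (halt : ∀ j, j + 2 ≤ m → V.coeff j * V.coeff (j + 2) < 0)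
    (a : ℝ) (ha : a ≠ 0)
    (W : Polynomial ℝ) (hW : W = (X ^ 2 - C (a ^ 2)) * V) :
    W.natDegree = m + 2 ∧
    (∀ j ≤ m + 2, W.coeff j ≠ 0) ∧
    (∀ j, 2 ≤ j → j ≤ m + 2 → 0 < W.coeff j * V.coeff (j - 2)) ∧
    W.coeff 0 * V.coeff 0 < 0 ∧
    W.coeff 1 * V.coeff 1 < 0 ∧
    (∀ j, j + 2 ≤ m + 2 → W.coeff j * W.coeff (j + 2) < 0) := by
  have ha2 : 0 < a ^ 2 := by positivity
  have hhigh : ∀ j ≤ m, 0 < W.coeff (j + 2) * V.coeff j := by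
    intro j hj
    have hsq : 0 < V.coeff j * V.coeff j := mul_self_pos.2 (hnz j hj)
    rw [hW, coeff_X_sq_sub_C_mul_add_two]
    rcases le_or_gt (j + 2) m with h | h
    · nlinarith [mul_neg_of_pos_of_neg ha2 (halt j h)]
    · rw [coeff_eq_zero_of_natDegree_lt (hdeg.trans_lt h)]
      simpa using hsq
  have hlow : ∀ j < 2, W.coeff j * V.coeff j < 0 := by
    intro j hj
    have hsq : 0 < V.coeff j * V.coeff j := mul_self_pos.2 (hnz j (by omega))
    rw [hW, coeff_X_sq_sub_C_mul_of_lt_two _ _ hj]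
    nlinarith [mul_pos ha2 hsq]
  have hV : V ≠ 0 := by
    rintro rfl
    exact hnz 0 (Nat.zero_le m) (coeff_zero 0)
  refine ⟨?_, ?_, ?_, hlow 0 (by norm_num), hlow 1 (by norm_num), ?_⟩
  · rw [hW, natDegree_mul (X_pow_sub_C_ne_zero two_pos _) hV, natDegree_X_pow_sub_C, hdeg,
      add_comm]
  · intro j hj
    rcases lt_or_ge j 2 with h | h
    · exact left_ne_zero_of_mul (hlow j h).ne
    · obtain ⟨k, rfl⟩ := Nat.exists_eq_add_of_le' h
      exact left_ne_zero_of_mul (hhigh k (by omega)).ne'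
  · intro j h hj
    obtain ⟨k, rfl⟩ := Nat.exists_eq_add_of_le' h
    exact hhigh k (by omega)
  · intro j hj
    rcases lt_or_ge j 2 with h | h
    · refine neg_of_mul_neg_left ?_ (mul_self_nonneg (V.coeff j))
      linear_combination mul_neg_of_neg_of_pos (hlow j h) (hhigh j (by omega))
    · obtain ⟨k, rfl⟩ := Nat.exists_eq_add_of_le' h
      have hprod := mul_pos (hhigh k (by omega)) (hhigh (k + 2) (by omega))
      rw [mul_mul_mul_comm] at hprod
      exact neg_of_mul_pos_left hprod (halt k (by omega)).le
end

section
/- Let Q be a real polynomial of degree d ≥ 0 with all coefficients q_0, …, q_d nonzero. Then there exists ε₀ > 0 such that for every ε with 0 < ε < ε₀: (a) in the product (x − ε)·Q, for every k with 1 ≤ k ≤ d+1 the coefficient of x^k has the same sign as q_{k−1}, and the constant coefficient has sign opposite to q_0; (b) in the product (x + ε)·Q, for every k with 1 ≤ k ≤ d+1 the coefficient of x^k has the same sign as q_{k−1}, and the constant coefficient has the same sign as q_0. -/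
open Polynomial

/-- For `δ` near `0`, multiplying `Q` by `X + δ` shifts the signs of its coefficients up by one. -/
lemma eventually_coeff_X_add_C_mul_pos (Q : Polynomial ℝ) (d : ℕ)
    (hnz : ∀ k ≤ d, Q.coeff k ≠ 0) :
    ∀ᶠ δ in nhds (0 : ℝ), ∀ k ∈ Finset.range (d + 1),
      0 < ((X + C δ) * Q).coeff (k + 1) * Q.coeff k := by
  rw [Filter.eventually_all_finset]
  intro k hk
  have hk' : Q.coeff k ≠ 0 := hnz k (Nat.lt_succ_iff.mp (Finset.mem_range.mp hk))
  have hcont : Continuous fun δ : ℝ => (Q.coeff k + δ * Q.coeff (k + 1)) * Q.coeff k := by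
    fun_prop
  have hpos : 0 < (Q.coeff k + 0 * Q.coeff (k + 1)) * Q.coeff k := by
    simpa using mul_self_pos.mpr hk'
  filter_upwards [hcont.continuousAt.eventually_const_lt hpos] with δ hδ
  simpa [add_mul] using hδ

/-- for Q of degree d with all coefficients nonzero and ε > 0 small
enough, the product (x−ε)·Q has coefficient of x^k of the same sign as q_{k−1} for
1 ≤ k ≤ d+1 and constant coefficient of sign opposite to q_0; the product (x+ε)·Q
has coefficient of x^k of the same sign as q_{k−1} for 1 ≤ k ≤ d+1 and constant
coefficient of the same sign as q_0. -/
theorem stmt_12 (Q : Polynomial ℝ) (d : ℕ) (hdeg : Q.natDegree = d)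
    (hnz : ∀ k ≤ d, Q.coeff k ≠ 0) :
    ∃ ε₀ > (0 : ℝ), ∀ ε : ℝ, 0 < ε → ε < ε₀ →
      ((∀ k, 1 ≤ k → k ≤ d + 1 →
          0 < ((X - C ε) * Q).coeff k * Q.coeff (k - 1)) ∧
        ((X - C ε) * Q).coeff 0 * Q.coeff 0 < 0) ∧
      ((∀ k, 1 ≤ k → k ≤ d + 1 →
          0 < ((X + C ε) * Q).coeff k * Q.coeff (k - 1)) ∧
        0 < ((X + C ε) * Q).coeff 0 * Q.coeff 0) := by
  obtain ⟨ε₀, hε₀, h⟩ :=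
    Metric.eventually_nhds_iff.mp (eventually_coeff_X_add_C_mul_pos Q d hnz)
  have key : ∀ δ : ℝ, |δ| < ε₀ → ∀ k, 1 ≤ k → k ≤ d + 1 →
      0 < ((X + C δ) * Q).coeff k * Q.coeff (k - 1) := by
    intro δ hδ k hk hkd
    obtain ⟨j, rfl⟩ := Nat.exists_eq_add_of_le' hk
    exact h (by simpa using hδ) j (Finset.mem_range.mpr hkd)
  have h0 : 0 < Q.coeff 0 * Q.coeff 0 := mul_self_pos.mpr (hnz 0 d.zero_le)
  refine ⟨ε₀, hε₀, fun ε hε hlt => ⟨⟨?_, ?_⟩, key ε (by rwa [abs_of_pos hε]), ?_⟩⟩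
  · simpa [sub_eq_add_neg] using key (-ε) (by rwa [abs_neg, abs_of_pos hε])
  · simpa [mul_coeff_zero, mul_assoc] using mul_pos hε h0
  · simpa [mul_coeff_zero, mul_assoc] using mul_pos hε h0
end
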